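/- arXiv:1909.09127 — 2 statements merged into one kernel-verified Lean document; each statement's English description precedes it below -/
import Mathlib

section
/- For every d ≥ 24, the Todd class of the permutohedral variety X_d is not effective: there is no function r assigning a nonnegative rational number to each chain in B̄ (including the empty chain) such that ∑_{S_•} r(S_•)·x_{S_•} ≡ Td_d modulo I_1 + I_2, i.e., the Todd class cannot be written as a nonnegative ℚ-linear combination of the classes of the torus-invariant cycles. -/
open MvPolynomial

/-- Subsets of the ground set `{1, …, d+1}` (modeled as `Fin (d+1)`). -/
abbrev Subs (d : ℕ) := Finset (Fin (d + 1))

/-- The polynomial ring `R_d` with one variable `x_S` for each subset `S`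
(only the variables indexed by proper nonempty subsets are ever used). -/
abbrev Rd (d : ℕ) := MvPolynomial (Subs d) ℚ

/-- `S ∈ B̄`, i.e. `S ≠ ∅` and `S ≠ {1,…,d+1}`. -/
def isProper (d : ℕ) (S : Subs d) : Prop := S ≠ ∅ ∧ S ≠ Finset.univ

instance (d : ℕ) (S : Subs d) : Decidable (isProper d S) := by
  unfold isProper; infer_instance

/-- The ideal `I₁` generated by products of variables indexed by incomparable
members of `B̄`. -/
noncomputable def I1 (d : ℕ) : Ideal (Rd d) :=
  Ideal.span {p | ∃ S S' : Subs d, isProper d S ∧ isProper d S' ∧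
    ¬ S ⊆ S' ∧ ¬ S' ⊆ S ∧ p = X S * X S'}

/-- `ℓ_a = ∑_{S ∈ B̄, a ∈ S} x_S`. -/
noncomputable def ell (d : ℕ) (a : Fin (d + 1)) : Rd d :=
  ∑ S ∈ Finset.univ.filter (fun S : Subs d => isProper d S ∧ a ∈ S), X S

/-- The ideal `I₂` generated by the differences `ℓ_a - ℓ_b`. -/
noncomputable def I2 (d : ℕ) : Ideal (Rd d) :=
  Ideal.span {p | ∃ a b : Fin (d + 1), p = ell d a - ell d b}

/-- The ideal `I₁ + I₂`; the Chow ring of the permutohedral variety is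
`A_d = R_d/(I₁+I₂)`, and an identity holds "in `A_d`" iff the difference of
the two sides lies in `Itot d`. -/
noncomputable def Itot (d : ℕ) : Ideal (Rd d) := I1 d + I2 d

/-- `τ_m = B'_m/m!`, the coefficients of `x/(1-e^{-x})` (with `B'₁ = +1/2`). -/
noncomputable def tau (m : ℕ) : ℚ := bernoulli' m / m.factorial

/-- The Todd polynomial `Td_d = ∏_{S ∈ B̄} (∑_{m=0}^{d} τ_m x_S^m)`. -/
noncomputable def Td (d : ℕ) : Rd d :=
  ∏ S ∈ Finset.univ.filter (fun S : Subs d => isProper d S),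
    ∑ m ∈ Finset.range (d + 1), C (tau m) * X S ^ m

/-- A finite set of subsets is a (proper) chain in `B̄` if all its members are
proper and any two of its members are comparable. -/
def IsProperChain (d : ℕ) (H : Finset (Subs d)) : Prop :=
  (∀ T ∈ H, isProper d T) ∧ ∀ T ∈ H, ∀ T' ∈ H, T ⊆ T' ∨ T' ⊆ T

instance (d : ℕ) (H : Finset (Subs d)) : Decidable (IsProperChain d H) := by
  unfold IsProperChain; infer_instance

/-- The square-free monomial `x_{S_•} = ∏_{T ∈ S_•} x_T` of a chain. -/
noncomputable def chainMon (d : ℕ) (H : Finset (Subs d)) : Rd d := ∏ T ∈ H, X T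

/-- sizes of the special flag -/
def szz : Fin 4 → ℕ := ![10, 12, 13, 15]

/-- values of the functional on monomials -/
def Tt (N : ℚ) (a b c d : ℕ) : ℚ :=
  if a + b + c + d = 4 then
    (match a * 1000 + b * 100 + c * 10 + d with
    | 4 => (-4/45) * ((N-10)*(N-12)*(N-13))
    | 31 => (20/39) * ((N-10)*(N-12)*(N-13))
    | 40 => (-20/13) * ((N-10)*(N-12)*(N-15))
    | 202 => (5/18) * ((N-10)*(N-12)*(N-13))
    | 211 => (-5/6) * ((N-10)*(N-12)*(N-13))
    | 220 => (5/6) * ((N-10)*(N-12)*(N-15))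
    | 301 => (10/9) * ((N-10)*(N-12)*(N-13))
    | 400 => (-5/3) * ((N-10)*(N-15)*(N-13))
    | 1003 => (2/15) * ((N-10)*(N-12)*(N-13))
    | 1021 => (-2/3) * ((N-10)*(N-12)*(N-13))
    | 1030 => (4/3) * ((N-10)*(N-12)*(N-15))
    | 1102 => (-1/3) * ((N-10)*(N-12)*(N-13))
    | 1111 => ((N-10)*(N-12)*(N-13))
    | 1120 => (-1) * ((N-10)*(N-12)*(N-15))
    | 1201 => (-2/3) * ((N-10)*(N-12)*(N-13))
    | 1300 => (2/3) * ((N-10)*(N-15)*(N-13))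
    | 2002 => (1/5) * ((N-10)*(N-12)*(N-13))
    | 2011 => (-1/3) * ((N-10)*(N-12)*(N-13))
    | 2020 => (1/3) * ((N-10)*(N-12)*(N-15))
    | 3001 => (2/15) * ((N-10)*(N-12)*(N-13))
    | 4000 => (-2/15) * ((N-15)*(N-12)*(N-13))
    | _ => 0)
  else 0

theorem Tt_zero (N : ℚ) (a b c d : ℕ) (h : a + b + c + d ≠ 4) : Tt N a b c d = 0 := by
  simp [Tt, h]

/-- matrix entries -/
def cc (N : ℚ) (i j : Fin 4) : ℚ :=
  N * (min (szz i) (szz j) : ℕ) - (szz i : ℚ) * (szz j : ℚ)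

theorem Tt_vals (N : ℚ) :
    Tt N 0 0 0 4 = (-4/45) * ((N-10)*(N-12)*(N-13)) ∧
    Tt N 0 0 1 3 = 0 ∧
    Tt N 0 0 2 2 = 0 ∧
    Tt N 0 0 3 1 = (20/39) * ((N-10)*(N-12)*(N-13)) ∧
    Tt N 0 0 4 0 = (-20/13) * ((N-10)*(N-12)*(N-15)) ∧
    Tt N 0 1 0 3 = 0 ∧
    Tt N 0 1 1 2 = 0 ∧
    Tt N 0 1 2 1 = 0 ∧
    Tt N 0 1 3 0 = 0 ∧
    Tt N 0 2 0 2 = (5/18) * ((N-10)*(N-12)*(N-13)) ∧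
    Tt N 0 2 1 1 = (-5/6) * ((N-10)*(N-12)*(N-13)) ∧
    Tt N 0 2 2 0 = (5/6) * ((N-10)*(N-12)*(N-15)) ∧
    Tt N 0 3 0 1 = (10/9) * ((N-10)*(N-12)*(N-13)) ∧
    Tt N 0 3 1 0 = 0 ∧
    Tt N 0 4 0 0 = (-5/3) * ((N-10)*(N-15)*(N-13)) ∧
    Tt N 1 0 0 3 = (2/15) * ((N-10)*(N-12)*(N-13)) ∧
    Tt N 1 0 1 2 = 0 ∧
    Tt N 1 0 2 1 = (-2/3) * ((N-10)*(N-12)*(N-13)) ∧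
    Tt N 1 0 3 0 = (4/3) * ((N-10)*(N-12)*(N-15)) ∧
    Tt N 1 1 0 2 = (-1/3) * ((N-10)*(N-12)*(N-13)) ∧
    Tt N 1 1 1 1 = ((N-10)*(N-12)*(N-13)) ∧
    Tt N 1 1 2 0 = (-1) * ((N-10)*(N-12)*(N-15)) ∧
    Tt N 1 2 0 1 = (-2/3) * ((N-10)*(N-12)*(N-13)) ∧
    Tt N 1 2 1 0 = 0 ∧
    Tt N 1 3 0 0 = (2/3) * ((N-10)*(N-15)*(N-13)) ∧
    Tt N 2 0 0 2 = (1/5) * ((N-10)*(N-12)*(N-13)) ∧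
    Tt N 2 0 1 1 = (-1/3) * ((N-10)*(N-12)*(N-13)) ∧
    Tt N 2 0 2 0 = (1/3) * ((N-10)*(N-12)*(N-15)) ∧
    Tt N 2 1 0 1 = 0 ∧
    Tt N 2 1 1 0 = 0 ∧
    Tt N 2 2 0 0 = 0 ∧
    Tt N 3 0 0 1 = (2/15) * ((N-10)*(N-12)*(N-13)) ∧
    Tt N 3 0 1 0 = 0 ∧
    Tt N 3 1 0 0 = 0 ∧
    Tt N 4 0 0 0 = (-2/15) * ((N-15)*(N-12)*(N-13)) := by
  refine ⟨?_, ?_, ?_, ?_, ?_, ?_, ?_, ?_, ?_, ?_, ?_, ?_, ?_, ?_, ?_, ?_, ?_, ?_, ?_, ?_, ?_, ?_, ?_, ?_, ?_, ?_, ?_, ?_, ?_, ?_, ?_, ?_, ?_, ?_, ?_⟩ <;> simp [Tt]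

theorem cc_vals (N : ℚ) :
    cc N 0 0 = N * 10 - 10 * 10 ∧
    cc N 0 1 = N * 10 - 10 * 12 ∧
    cc N 0 2 = N * 10 - 10 * 13 ∧
    cc N 0 3 = N * 10 - 10 * 15 ∧
    cc N 1 0 = N * 10 - 12 * 10 ∧
    cc N 1 1 = N * 12 - 12 * 12 ∧
    cc N 1 2 = N * 12 - 12 * 13 ∧
    cc N 1 3 = N * 12 - 12 * 15 ∧
    cc N 2 0 = N * 10 - 13 * 10 ∧
    cc N 2 1 = N * 12 - 13 * 12 ∧
    cc N 2 2 = N * 13 - 13 * 13 ∧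
    cc N 2 3 = N * 13 - 13 * 15 ∧
    cc N 3 0 = N * 10 - 15 * 10 ∧
    cc N 3 1 = N * 12 - 15 * 12 ∧
    cc N 3 2 = N * 13 - 15 * 13 ∧
    cc N 3 3 = N * 15 - 15 * 15 := by
  refine ⟨?_, ?_, ?_, ?_, ?_, ?_, ?_, ?_, ?_, ?_, ?_, ?_, ?_, ?_, ?_, ?_⟩ <;> simp [cc, szz]

set_option maxHeartbeats 4000000 in
theorem Tt_rel (N : ℚ) (m : Fin 4 → ℕ) (i : Fin 4) :
    ∑ j, cc N i j * Tt N (m 0 + (if i = 0 then 1 else 0) + (if j = 0 then 1 else 0))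
      (m 1 + (if i = 1 then 1 else 0) + (if j = 1 then 1 else 0))
      (m 2 + (if i = 2 then 1 else 0) + (if j = 2 then 1 else 0))
      (m 3 + (if i = 3 then 1 else 0) + (if j = 3 then 1 else 0)) = 0 := by
  generalize m 0 = a
  generalize m 1 = b
  generalize m 2 = c
  generalize m 3 = d
  by_cases h : a + b + c + d = 2
  · rw [Fin.sum_univ_four]
    have hi : ∀ i : Fin 4, i = 0 ∨ i = 1 ∨ i = 2 ∨ i = 3 := by decide
    obtain rfl | rfl | rfl : a = 0 ∨ a = 1 ∨ a = 2 := by omega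
    all_goals obtain rfl | rfl | rfl : b = 0 ∨ b = 1 ∨ b = 2 := by omega
    all_goals obtain rfl | rfl | rfl : c = 0 ∨ c = 1 ∨ c = 2 := by omega
    all_goals obtain rfl | rfl | rfl : d = 0 ∨ d = 1 ∨ d = 2 := by omega
    all_goals first | (exfalso; omega) | skip
    all_goals obtain rfl | rfl | rfl | rfl := hi i
    all_goals
      simp only [Fin.isValue, Fin.reduceEq, if_true, if_false, Nat.reduceAdd, Tt_vals, cc_vals]
      ring
  · apply Finset.sum_eq_zero
    intro j _
    rw [Tt_zero, mul_zero]
    have h1 : (if i = 0 then 1 else 0) + (if i = 1 then 1 else 0) + (if i = 2 then 1 else 0)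
      + (if i = 3 then 1 else 0) = 1 := by clear h; revert i; decide
    have h2 : (if j = 0 then 1 else 0) + (if j = 1 then 1 else 0) + (if j = 2 then 1 else 0)
      + (if j = 3 then 1 else 0) = 1 := by clear h; revert j; decide
    omega

/-- the functional on polynomials in four variables -/
noncomputable def lam (N : ℚ) : MvPolynomial (Fin 4) ℚ →ₗ[ℚ] ℚ :=
  (MvPolynomial.basisMonomials (Fin 4) ℚ).constr ℚ (fun m => Tt N (m 0) (m 1) (m 2) (m 3))

theorem lam_monomial (N : ℚ) (m : Fin 4 →₀ ℕ) (c : ℚ) :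
    lam N (monomial m c) = c * Tt N (m 0) (m 1) (m 2) (m 3) := by
  have h1 : lam N (monomial m 1) = Tt N (m 0) (m 1) (m 2) (m 3) := by
    have := (MvPolynomial.basisMonomials (Fin 4) ℚ).constr_basis ℚ
      (fun m => Tt N (m 0) (m 1) (m 2) (m 3)) m
    simpa [lam] using this
  have h2 : (monomial m c : MvPolynomial (Fin 4) ℚ) = c • monomial m 1 := by
    rw [smul_monomial]; simp
  rw [h2, map_smul, h1, smul_eq_mul]

theorem lam_kill (N : ℚ) (i : Fin 4) (p : MvPolynomial (Fin 4) ℚ) :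
    lam N (p * X i * ∑ j, C (cc N i j) * X j) = 0 := by
  induction p using MvPolynomial.induction_on' with
  | add p q hp hq => rw [add_mul, add_mul, map_add, hp, hq, add_zero]
  | monomial m c =>
    rw [Finset.mul_sum, map_sum]
    have : ∀ j, lam N ((monomial m c : MvPolynomial (Fin 4) ℚ) * X i * (C (cc N i j) * X j)) =
        c * (cc N i j *
      Tt N (m 0 + (if i = 0 then 1 else 0) + (if j = 0 then 1 else 0))
      (m 1 + (if i = 1 then 1 else 0) + (if j = 1 then 1 else 0))
      (m 2 + (if i = 2 then 1 else 0) + (if j = 2 then 1 else 0))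
      (m 3 + (if i = 3 then 1 else 0) + (if j = 3 then 1 else 0))) := by
      intro j
      rw [X, X, C_mul_monomial, monomial_mul, monomial_mul, lam_monomial]
      simp only [Finsupp.add_apply, Finsupp.single_apply]
      ring
    simp_rw [this]
    rw [← Finset.mul_sum, Tt_rel, mul_zero]

/-- flag of a permutation -/
def Fs (d : ℕ) (σ : Equiv.Perm (Fin (d+1))) (i : Fin 4) : Subs d :=
  Finset.univ.filter (fun x => (σ x).val < szz i)

theorem szz_lt (i : Fin 4) : szz i < 25 := by fin_cases i <;> simp [szz]
theorem szz_pos (i : Fin 4) : 0 < szz i := by fin_cases i <;> simp [szz]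
theorem szz_inj : Function.Injective szz := by decide

theorem card_lt (d k : ℕ) (hk : k ≤ d + 1) :
    (Finset.univ.filter (fun x : Fin (d+1) => x.val < k)).card = k := by
  rw [Fin.card_filter_val_lt]; omega

theorem Fs_card (d : ℕ) (hd : 24 ≤ d) (σ : Equiv.Perm (Fin (d+1))) (i : Fin 4) :
    (Fs d σ i).card = szz i := by
  rw [← card_lt d (szz i) (by have := szz_lt i; omega)]
  refine Finset.card_bij (fun x _ => σ x) ?_ ?_ ?_
  · intro x hx; simpa [Fs] using hx
  · intro x _ y _ h; exact σ.injective h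
  · intro y hy; exact ⟨σ.symm y, by simpa [Fs] using hy, by simp⟩

theorem Fs_inj (d : ℕ) (hd : 24 ≤ d) (σ : Equiv.Perm (Fin (d+1))) :
    Function.Injective (Fs d σ) := by
  intro i j h
  apply szz_inj
  rw [← Fs_card d hd σ i, ← Fs_card d hd σ j, h]

theorem Fs_proper (d : ℕ) (hd : 24 ≤ d) (σ : Equiv.Perm (Fin (d+1))) (i : Fin 4) :
    isProper d (Fs d σ i) := by
  have h := Fs_card d hd σ i
  have h1 := szz_lt i
  have h2 := szz_pos i
  constructor
  · intro h'; rw [h'] at h; simp at h; omega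
  · intro h'; rw [h'] at h; simp at h; omega

theorem Fs_comp (d : ℕ) (σ : Equiv.Perm (Fin (d+1))) (i j : Fin 4) :
    Fs d σ i ⊆ Fs d σ j ∨ Fs d σ j ⊆ Fs d σ i := by
  rcases le_total (szz i) (szz j) with h | h
  · left; intro x hx; simp only [Fs, Finset.mem_filter, Finset.mem_univ, true_and] at hx ⊢; omega
  · right; intro x hx; simp only [Fs, Finset.mem_filter, Finset.mem_univ, true_and] at hx ⊢; omega

/-- restriction to the flag of a permutation -/
noncomputable def ee (d : ℕ) (σ : Equiv.Perm (Fin (d+1))) : Rd d →ₐ[ℚ] MvPolynomial (Fin 4) ℚ :=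
  aeval (fun S => ∑ i, if S = Fs d σ i then X i else 0)

theorem ee_X (d : ℕ) (σ : Equiv.Perm (Fin (d+1))) (S : Subs d) :
    ee d σ (X S) = ∑ i, if S = Fs d σ i then X i else 0 := by
  simp [ee]

theorem ee_Fs (d : ℕ) (hd : 24 ≤ d) (σ : Equiv.Perm (Fin (d+1))) (i : Fin 4) :
    ee d σ (X (Fs d σ i)) = X i := by
  rw [ee_X, Finset.sum_eq_single i]
  · simp
  · intro j _ hj
    rw [if_neg]
    intro h; exact hj (Fs_inj d hd σ h).symm
  · simp

theorem ee_X_zero (d : ℕ) (σ : Equiv.Perm (Fin (d+1))) (S : Subs d) (h : ∀ i, S ≠ Fs d σ i) :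
    ee d σ (X S) = 0 := by
  rw [ee_X]
  exact Finset.sum_eq_zero (fun i _ => if_neg (h i))

/-- restricted linear function -/
noncomputable def uu (d : ℕ) (x : Fin (d+1)) : MvPolynomial (Fin 4) ℚ :=
  ∑ j, if x.val < szz j then X j else 0

theorem ee_ell (d : ℕ) (hd : 24 ≤ d) (σ : Equiv.Perm (Fin (d+1))) (a : Fin (d+1)) :
    ee d σ (ell d a) = uu d (σ a) := by
  rw [ell, map_sum]
  simp_rw [ee_X]
  rw [Finset.sum_comm, uu]
  refine Finset.sum_congr rfl (fun j _ => ?_)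
  rw [Finset.sum_ite_eq']
  have h1 := Fs_proper d hd σ j
  have h2 : a ∈ Fs d σ j ↔ (σ a).val < szz j := by simp [Fs]
  simp only [Finset.mem_filter, Finset.mem_univ, true_and, h1, h2]

/-- normalized linear function -/
noncomputable def vv (d : ℕ) (x : Fin (d+1)) : MvPolynomial (Fin 4) ℚ :=
  C ((d : ℚ) + 1) * uu d x - ∑ y, uu d y

theorem sum_uu (d k : ℕ) (hd : 24 ≤ d) (hk : k ≤ d + 1) :
    ∑ y ∈ Finset.univ.filter (fun x : Fin (d+1) => x.val < k), uu d y =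
      ∑ j, C ((min k (szz j) : ℕ) : ℚ) * X j := by
  simp only [uu]
  rw [Finset.sum_comm]
  refine Finset.sum_congr rfl (fun j _ => ?_)
  rw [← Finset.sum_filter, Finset.filter_filter, Finset.sum_const]
  have : (Finset.univ.filter (fun x : Fin (d+1) => x.val < k ∧ x.val < szz j)) =
      Finset.univ.filter (fun x : Fin (d+1) => x.val < min k (szz j)) := by
    ext x; simp
  rw [this, card_lt d _ (by omega), nsmul_eq_mul, map_natCast]

theorem sum_vv_univ (d : ℕ) : ∑ y, vv d y = 0 := by
  simp only [vv]
  rw [Finset.sum_sub_distrib, ← Finset.mul_sum, Finset.sum_const]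
  simp

theorem sum_vv (d : ℕ) (hd : 24 ≤ d) (i : Fin 4) :
    ∑ y ∈ Finset.univ.filter (fun x : Fin (d+1) => x.val < szz i), vv d y =
      ∑ j, C (cc ((d:ℚ)+1) i j) * X j := by
  have hi := szz_lt i
  have h1 := sum_uu d (szz i) hd (by omega)
  have h2 := sum_uu d (d+1) hd le_rfl
  have h3 : (Finset.univ.filter (fun x : Fin (d+1) => x.val < d + 1)) = Finset.univ := by
    ext x; simp [x.isLt, Nat.le_of_lt_succ]
  rw [h3] at h2
  simp only [vv]
  rw [Finset.sum_sub_distrib, ← Finset.mul_sum, Finset.sum_const, card_lt d _ (by omega), h1, h2,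
    nsmul_eq_mul, Finset.mul_sum, Finset.mul_sum, ← Finset.sum_sub_distrib]
  refine Finset.sum_congr rfl (fun j _ => ?_)
  have hj := szz_lt j
  rw [min_eq_right (by omega : szz j ≤ d + 1), cc]
  simp only [map_sub, map_mul, map_natCast]
  ring

theorem sum_vv_Fs (d : ℕ) (hd : 24 ≤ d) (σ : Equiv.Perm (Fin (d+1))) (i : Fin 4) :
    ∑ x ∈ Fs d σ i, vv d (σ x) = ∑ j, C (cc ((d:ℚ)+1) i j) * X j := by
  rw [← sum_vv d hd i]
  refine Finset.sum_bij (fun x _ => σ x) ?_ ?_ ?_ ?_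
  · intro x hx; simpa [Fs] using hx
  · intro x _ y _ h; exact σ.injective h
  · intro y hy; exact ⟨σ.symm y, by simpa [Fs] using hy, by simp⟩
  · intros; rfl

/-- the functional -/
noncomputable def phi (d : ℕ) : Rd d →ₗ[ℚ] ℚ :=
  ∑ σ : Equiv.Perm (Fin (d+1)), (lam ((d:ℚ)+1)).comp (ee d σ).toLinearMap

theorem phi_apply (d : ℕ) (f : Rd d) :
    phi d f = ∑ σ : Equiv.Perm (Fin (d+1)), lam ((d:ℚ)+1) (ee d σ f) := by
  simp [phi]

theorem block_lemma {n : ℕ} (𝒞 : Finset (Finset (Fin n)))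
    (hch : ∀ S ∈ 𝒞, ∀ T ∈ 𝒞, S ⊆ T ∨ T ⊆ S) (t : Fin n → ℚ)
    (h1 : ∀ a b, (∀ S ∈ 𝒞, a ∈ S ↔ b ∈ S) → t a = t b)
    (h2 : ∀ S ∈ 𝒞, ∑ x ∈ S, t x = 0) (h3 : ∑ x, t x = 0) (a : Fin n) : t a = 0 := by
  classical
  set 𝒟 := insert ∅ (insert Finset.univ 𝒞) with h𝒟
  have hch' : ∀ S ∈ 𝒟, ∀ T ∈ 𝒟, S ⊆ T ∨ T ⊆ S := by
    intro S hS T hT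
    simp only [h𝒟, Finset.mem_insert] at hS hT
    rcases hS with rfl | rfl | hS
    · simp
    · simp
    rcases hT with rfl | rfl | hT
    · simp
    · simp
    exact hch S hS T hT
  have h2' : ∀ S ∈ 𝒟, ∑ x ∈ S, t x = 0 := by
    intro S hS
    simp only [h𝒟, Finset.mem_insert] at hS
    rcases hS with rfl | rfl | hS
    · simp
    · exact h3
    · exact h2 S hS
  obtain ⟨U, hU, hUm⟩ := Finset.exists_min_image (𝒟.filter (fun S => a ∈ S)) Finset.card
    ⟨Finset.univ, by simp [h𝒟]⟩
  obtain ⟨L, hL, hLm⟩ := Finset.exists_max_image (𝒟.filter (fun S => a ∉ S)) Finset.card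
    ⟨∅, by simp [h𝒟]⟩
  rw [Finset.mem_filter] at hU hL
  have hLU : L ⊆ U := by
    rcases hch' L hL.1 U hU.1 with h | h
    · exact h
    · exact absurd (h hU.2) hL.2
  have hs : ∑ x ∈ U \ L, t x = 0 := by
    have := Finset.sum_sdiff (f := t) hLU
    rw [h2' L hL.1, h2' U hU.1] at this
    simpa using this
  have hc : ∀ x ∈ U \ L, t x = t a := by
    intro x hx
    rw [Finset.mem_sdiff] at hx
    apply h1
    intro S hS
    have hS' : S ∈ 𝒟 := by simp [h𝒟, hS]
    by_cases ha : a ∈ S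
    · have hle := hUm S (by simp [hS', ha])
      have : U ⊆ S := by
        rcases hch' U hU.1 S hS' with h | h
        · exact h
        · exact (Finset.eq_of_subset_of_card_le h hle).ge
      exact ⟨fun _ => ha, fun _ => this hx.1⟩
    · have hle := hLm S (by simp [hS', ha])
      have : S ⊆ L := by
        rcases hch' S hS' L hL.1 with h | h
        · exact h
        · exact (Finset.eq_of_subset_of_card_le h hle).ge
      exact ⟨fun h => absurd (this h) hx.2, fun h => absurd h ha⟩
  rw [Finset.sum_congr rfl hc, Finset.sum_const, nsmul_eq_mul] at hs
  rcases mul_eq_zero.1 hs with h | h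
  · exfalso
    have h' : (U \ L).card = 0 := by exact_mod_cast h
    rw [Finset.card_eq_zero] at h'
    have : a ∈ U \ L := by simp [hU.2, hL.2]
    rw [h'] at this
    simp at this
  · exact h

theorem ee_monomial (d : ℕ) (σ : Equiv.Perm (Fin (d+1))) (m : Subs d →₀ ℕ) (c : ℚ) :
    ee d σ (monomial m c) = C c * ∏ S ∈ m.support, (ee d σ (X S)) ^ (m S) := by
  rw [monomial_eq, map_mul, Finsupp.prod, map_prod]
  simp_rw [map_pow]
  congr 1
  simp [ee]

theorem ee_monomial_dvd (d : ℕ) (σ : Equiv.Perm (Fin (d+1))) (m : Subs d →₀ ℕ) (c : ℚ)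
    (S : Subs d) (hS : S ∈ m.support) :
    ∃ q, ee d σ (monomial m c) = q * ee d σ (X S) := by
  have h : ee d σ (X S) ∣ ee d σ (monomial m c) := by
    rw [ee_monomial]
    apply Dvd.dvd.mul_left
    refine dvd_trans (dvd_pow_self _ ?_) (Finset.dvd_prod_of_mem _ hS)
    exact Finsupp.mem_support_iff.1 hS
  obtain ⟨q, hq⟩ := h
  exact ⟨q, by rw [hq, mul_comm]⟩

theorem Fs_swap (d : ℕ) (σ : Equiv.Perm (Fin (d+1))) (S : Subs d) (a b : Fin (d+1))
    (h : a ∈ S ↔ b ∈ S) (i : Fin 4) :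
    S = Fs d (σ * Equiv.swap a b) i ↔ S = Fs d σ i := by
  have hsw : ∀ x, Equiv.swap a b x ∈ S ↔ x ∈ S := by
    intro x
    rcases eq_or_ne x a with rfl | hxa
    · simp [h]
    rcases eq_or_ne x b with rfl | hxb
    · simp [h]
    rw [Equiv.swap_apply_of_ne_of_ne hxa hxb]
  have hm : ∀ (τ : Equiv.Perm (Fin (d+1))) x, x ∈ Fs d τ i ↔ (τ x).val < szz i := by
    intro τ x; simp [Fs]
  constructor
  · intro hS
    ext x
    have := Finset.ext_iff.1 hS (Equiv.swap a b x)
    rw [hsw] at this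
    rw [this, hm, hm, Equiv.Perm.mul_apply, Equiv.swap_apply_self]
  · intro hS
    ext x
    have := Finset.ext_iff.1 hS (Equiv.swap a b x)
    rw [hsw] at this
    rw [this, hm, hm, Equiv.Perm.mul_apply]

theorem sum_mulRight {G : Type} [Group G] [Fintype G] (τ : G) (f : G → ℚ) :
    ∑ σ, f σ = ∑ σ, f (σ * τ) :=
  (Equiv.sum_comp (Equiv.mulRight τ) f).symm

theorem key (d : ℕ) (hd : 24 ≤ d) (m : Subs d →₀ ℕ) (c : ℚ) (a : Fin (d+1)) :
    ∑ σ : Equiv.Perm (Fin (d+1)),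
      lam ((d:ℚ)+1) (ee d σ (monomial m c) * vv d (σ a)) = 0 := by
  by_cases hz : ∀ σ : Equiv.Perm (Fin (d+1)), ee d σ (monomial m c) = 0
  · simp [hz]
  push Not at hz
  obtain ⟨σ₀, hσ₀⟩ := hz
  have hF : ∀ S ∈ m.support, ∃ i, S = Fs d σ₀ i := by
    intro S hS
    by_contra hcon
    push Not at hcon
    obtain ⟨q, hq⟩ := ee_monomial_dvd d σ₀ m c S hS
    rw [ee_X_zero d σ₀ S hcon, mul_zero] at hq
    exact hσ₀ hq
  refine block_lemma m.support ?_ (fun a => ∑ σ : Equiv.Perm (Fin (d+1)),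
      lam ((d:ℚ)+1) (ee d σ (monomial m c) * vv d (σ a))) ?_ ?_ ?_ a
  · intro S hS T hT
    obtain ⟨i, rfl⟩ := hF S hS
    obtain ⟨j, rfl⟩ := hF T hT
    exact Fs_comp d σ₀ i j
  · intro a b hab
    rw [sum_mulRight (Equiv.swap a b)
      (fun σ => lam ((d:ℚ)+1) (ee d σ (monomial m c) * vv d (σ a)))]
    refine Finset.sum_congr rfl (fun σ _ => ?_)
    have : ee d (σ * Equiv.swap a b) (monomial m c) = ee d σ (monomial m c) := by
      rw [ee_monomial, ee_monomial]
      refine congrArg (fun z => C c * z) (Finset.prod_congr rfl (fun S hS => ?_))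
      rw [ee_X, ee_X]
      simp only [Fs_swap d σ S a b (hab S hS)]
    rw [this, Equiv.Perm.mul_apply, Equiv.swap_apply_left]
  · intro S hS
    rw [Finset.sum_comm]
    refine Finset.sum_eq_zero (fun σ _ => ?_)
    rw [← map_sum, ← Finset.mul_sum]
    obtain ⟨q, hq⟩ := ee_monomial_dvd d σ m c S hS
    rw [hq]
    by_cases h : ∃ i, S = Fs d σ i
    · obtain ⟨i, rfl⟩ := h
      rw [ee_Fs d hd, sum_vv_Fs d hd, lam_kill]
    · push Not at h
      rw [ee_X_zero d σ S h]; simp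
  · rw [Finset.sum_comm]
    refine Finset.sum_eq_zero (fun σ _ => ?_)
    rw [← map_sum, ← Finset.mul_sum, Equiv.sum_comp σ (vv d), sum_vv_univ]
    simp

theorem phi_I2 (d : ℕ) (hd : 24 ≤ d) (a b : Fin (d+1)) (p : Rd d) :
    phi d (p * (ell d a - ell d b)) = 0 := by
  induction p using MvPolynomial.induction_on' with
  | add p q hp hq => rw [add_mul, map_add, hp, hq, add_zero]
  | monomial m c =>
    have hN : ((d:ℚ)+1) ≠ 0 := by positivity
    apply mul_left_cancel₀ hN
    rw [mul_zero, phi_apply, Finset.mul_sum]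
    have h := congrArg₂ (· - ·) (key d hd m c a) (key d hd m c b)
    simp only [sub_self] at h
    rw [← Finset.sum_sub_distrib] at h
    rw [← h]
    refine Finset.sum_congr rfl (fun σ _ => ?_)
    rw [← map_sub, ← smul_eq_mul, ← map_smul]
    congr 1
    rw [map_mul, map_sub, ee_ell d hd, ee_ell d hd, vv, vv, smul_eq_C_mul]
    ring

theorem phi_I1 (d : ℕ) (S S' : Subs d) (h : ¬ S ⊆ S') (h' : ¬ S' ⊆ S) (p : Rd d) :
    phi d (p * (X S * X S')) = 0 := by
  rw [phi_apply]
  refine Finset.sum_eq_zero (fun σ _ => ?_)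
  have : ee d σ (X S) = 0 ∨ ee d σ (X S') = 0 := by
    by_contra hcon
    push Not at hcon
    have h1 : ∃ i, S = Fs d σ i := by
      by_contra h1; push Not at h1; exact hcon.1 (ee_X_zero d σ S h1)
    have h2 : ∃ i, S' = Fs d σ i := by
      by_contra h1; push Not at h1; exact hcon.2 (ee_X_zero d σ S' h1)
    obtain ⟨i, rfl⟩ := h1
    obtain ⟨j, rfl⟩ := h2
    rcases Fs_comp d σ i j with h3 | h3
    · exact h h3
    · exact h' h3
  rw [map_mul (ee d σ), map_mul (ee d σ)]
  rcases this with h1 | h1 <;> simp [h1]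

theorem phi_span (d : ℕ) (s : Set (Rd d)) (h : ∀ g ∈ s, ∀ p, phi d (p * g) = 0)
    (f : Rd d) (hf : f ∈ Ideal.span s) : phi d f = 0 := by
  have : ∀ p, phi d (p * f) = 0 := by
    induction hf using Submodule.span_induction with
    | mem x hx => exact h x hx
    | zero => simp
    | add x y _ _ hx hy => intro p; rw [mul_add, map_add, hx, hy, add_zero]
    | smul a x _ hx => intro p; rw [smul_eq_mul, ← mul_assoc]; exact hx _
  simpa using this 1

theorem phi_Itot (d : ℕ) (hd : 24 ≤ d) (f : Rd d) (hf : f ∈ Itot d) : phi d f = 0 := by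
  rw [Itot, Submodule.add_eq_sup, Submodule.mem_sup] at hf
  obtain ⟨y, hy, z, hz, rfl⟩ := hf
  rw [map_add, phi_span d _ _ y hy, phi_span d _ _ z hz, add_zero]
  · rintro g ⟨a, b, rfl⟩ p
    exact phi_I2 d hd a b p
  · rintro g ⟨S, S', _, _, h, h', rfl⟩ p
    exact phi_I1 d S S' h h' p

theorem lam_sqfree (N : ℚ) (hN : 25 ≤ N) (J : Finset (Fin 4)) :
    0 ≤ lam N (∏ i ∈ J, X i) := by
  have h : (∏ i ∈ J, X i : MvPolynomial (Fin 4) ℚ) =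
      monomial (∑ i ∈ J, Finsupp.single i 1) 1 := by
    rw [monomial_sum_one]; rfl
  rw [h, lam_monomial, one_mul]
  simp only [Finsupp.finsetSum_apply, Finsupp.single_apply, Finset.sum_ite_eq']
  by_cases h0 : (0 : Fin 4) ∈ J <;> by_cases h1 : (1 : Fin 4) ∈ J <;>
    by_cases h2 : (2 : Fin 4) ∈ J <;> by_cases h3 : (3 : Fin 4) ∈ J <;>
    simp [h0, h1, h2, h3, Tt]
  have e1 : 0 ≤ N - 10 := by linarith
  have e2 : 0 ≤ N - 12 := by linarith
  have e3 : 0 ≤ N - 13 := by linarith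
  positivity

theorem phi_chain (d : ℕ) (hd : 24 ≤ d) (H : Finset (Subs d)) : 0 ≤ phi d (chainMon d H) := by
  classical
  rw [phi_apply]
  refine Finset.sum_nonneg (fun σ _ => ?_)
  rw [chainMon, map_prod]
  by_cases h : ∀ T ∈ H, ∃ i, T = Fs d σ i
  · have hH : H = (Finset.univ.filter (fun i => Fs d σ i ∈ H)).image (Fs d σ) := by
      ext T
      simp only [Finset.mem_image, Finset.mem_filter, Finset.mem_univ, true_and]
      constructor
      · intro hT
        obtain ⟨i, rfl⟩ := h T hT
        exact ⟨i, hT, rfl⟩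
      · rintro ⟨i, hi, rfl⟩; exact hi
    rw [hH, Finset.prod_image (fun i _ j _ hij => Fs_inj d hd σ hij)]
    simp_rw [ee_Fs d hd]
    apply lam_sqfree
    have : (24:ℚ) ≤ d := by exact_mod_cast hd
    linarith
  · push Not at h
    obtain ⟨T, hT, hT'⟩ := h
    rw [Finset.prod_eq_zero hT (ee_X_zero d σ T hT')]
    simp

theorem tau0 : tau 0 = 1 := by simp [tau]
theorem tau1 : tau 1 = 1/2 := by simp [tau]
theorem tau2 : tau 2 = 1/12 := by simp [tau]; norm_num
theorem tau3 : tau 3 = 0 := by simp [tau]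
theorem tau4 : tau 4 = -1/720 := by
  simp [tau, Nat.factorial]; norm_num

theorem ee_Td (d : ℕ) (hd : 24 ≤ d) (σ : Equiv.Perm (Fin (d+1))) :
    ee d σ (Td d) = ∏ i : Fin 4, ∑ m ∈ Finset.range (d + 1), C (tau m) * X i ^ m := by
  classical
  have hC : ∀ c : ℚ, ee d σ (C c) = C c := fun c => by simp [ee]
  rw [Td, map_prod]
  simp only [map_sum, map_mul, map_pow, hC]
  rw [← Finset.prod_subset (s₁ := Finset.univ.image (Fs d σ))]
  · rw [Finset.prod_image (fun i _ j _ hij => Fs_inj d hd σ hij)]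
    simp_rw [ee_Fs d hd]
  · intro S hS
    simp only [Finset.mem_image, Finset.mem_univ, true_and] at hS
    obtain ⟨i, rfl⟩ := hS
    simpa using Fs_proper d hd σ i
  · intro S _ hS
    simp only [Finset.mem_image, Finset.mem_univ, true_and, not_exists] at hS
    rw [ee_X_zero d σ S (fun i h => hS i h.symm), Finset.sum_eq_single 0]
    · simp [tau0]
    · intro b _ hb; simp [hb]
    · simp

theorem sum_trunc (d : ℕ) (hd : 24 ≤ d) (f : ℕ → ℚ) (hf : ∀ m, 5 ≤ m → f m = 0) :
    ∑ m ∈ Finset.range (d+1), f m = f 0 + f 1 + f 2 + f 3 + f 4 := by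
  rw [← Finset.sum_subset (s₁ := Finset.range 5)]
  · simp [Finset.sum_range_succ]
  · intro x; simp; omega
  · intro x _ hx; apply hf; simpa using hx

set_option maxHeartbeats 4000000 in
theorem lam_Td (d : ℕ) (hd : 24 ≤ d) :
    lam ((d:ℚ)+1) (∏ i : Fin 4, ∑ m ∈ Finset.range (d + 1), C (tau m) * X i ^ m) < 0 := by
  have hm : ∀ a b c e : ℕ, lam ((d:ℚ)+1) (C (tau a) * X 0 ^ a * (C (tau b) * X 1 ^ b) *
      (C (tau c) * X 2 ^ c) * (C (tau e) * X 3 ^ e)) =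
      tau a * tau b * tau c * tau e * Tt ((d:ℚ)+1) a b c e := by
    intro a b c e
    simp only [X_pow_eq_monomial, C_mul_monomial, monomial_mul, lam_monomial]
    simp [Finsupp.single_apply]
  have hexp : (∏ i : Fin 4, ∑ m ∈ Finset.range (d + 1), C (tau m) * X i ^ m :
      MvPolynomial (Fin 4) ℚ) = ∑ a ∈ Finset.range (d + 1), ∑ b ∈ Finset.range (d + 1),
      ∑ c ∈ Finset.range (d + 1), ∑ e ∈ Finset.range (d + 1),
      (C (tau a) * X 0 ^ a * (C (tau b) * X 1 ^ b) *
      (C (tau c) * X 2 ^ c) * (C (tau e) * X 3 ^ e)) := by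
    rw [Fin.prod_univ_four]
    simp only [← Finset.sum_mul, ← Finset.mul_sum]
  rw [hexp]
  simp only [map_sum, hm]
  have S1 : ∀ a b c, ∑ e ∈ Finset.range (d + 1),
      tau a * tau b * tau c * tau e * Tt ((d:ℚ)+1) a b c e = _ := fun a b c =>
    sum_trunc d hd _ (fun m hm => by rw [Tt_zero _ _ _ _ _ (by omega), mul_zero])
  have S2 : ∀ a b, ∑ c ∈ Finset.range (d + 1), ∑ e ∈ Finset.range (d + 1),
      tau a * tau b * tau c * tau e * Tt ((d:ℚ)+1) a b c e = _ := fun a b =>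
    sum_trunc d hd _ (fun m hm => Finset.sum_eq_zero (fun e _ => by
      rw [Tt_zero _ _ _ _ _ (by omega), mul_zero]))
  have S3 : ∀ a, ∑ b ∈ Finset.range (d + 1), ∑ c ∈ Finset.range (d + 1),
      ∑ e ∈ Finset.range (d + 1),
      tau a * tau b * tau c * tau e * Tt ((d:ℚ)+1) a b c e = _ := fun a =>
    sum_trunc d hd _ (fun m hm => Finset.sum_eq_zero (fun c _ => Finset.sum_eq_zero (fun e _ => by
      rw [Tt_zero _ _ _ _ _ (by omega), mul_zero])))
  have S4 : ∑ a ∈ Finset.range (d + 1), ∑ b ∈ Finset.range (d + 1), ∑ c ∈ Finset.range (d + 1),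
      ∑ e ∈ Finset.range (d + 1),
      tau a * tau b * tau c * tau e * Tt ((d:ℚ)+1) a b c e = _ :=
    sum_trunc d hd _ (fun m hm => Finset.sum_eq_zero (fun b _ => Finset.sum_eq_zero
      (fun c _ => Finset.sum_eq_zero (fun e _ => by
      rw [Tt_zero _ _ _ _ _ (by omega), mul_zero]))))
  rw [S4]
  simp only [S3]
  simp only [S2]
  simp only [S1, tau3, zero_mul, mul_zero, add_zero, zero_add]
  have hz : ∀ a b c e : ℕ, (a + b + c + e == 4) = false → Tt ((d:ℚ)+1) a b c e = 0 := by
    intro a b c e h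
    exact Tt_zero _ _ _ _ _ (by simpa using h)
  simp only [hz, Nat.reduceAdd, Nat.reduceBEq, Tt_vals, tau0, tau1, tau2, tau4, mul_zero, Finset.sum_const_zero,
    add_zero, zero_add]
  clear S1 S2 S3 S4 hz hm hexp
  obtain ⟨t, rfl⟩ := Nat.exists_eq_add_of_le hd
  push_cast
  have ht : (0:ℚ) ≤ t := Nat.cast_nonneg t
  nlinarith [mul_nonneg ht ht, mul_nonneg ht (mul_nonneg ht ht)]

theorem phi_Td (d : ℕ) (hd : 24 ≤ d) : phi d (Td d) < 0 := by
  rw [phi_apply]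
  simp_rw [ee_Td d hd]
  exact Finset.sum_neg (fun σ _ => lam_Td d hd) ⟨1, Finset.mem_univ _⟩

/-- Theorem `thm:noneffective`: for every `d ≥ 24` the Todd class of
the permutohedral variety `X_d` is not effective: there is no assignment of
nonnegative rational coefficients to the chains in `B̄` whose square-free polynomial
represents the Todd class, i.e. is congruent to `Td_d` modulo `I₁+I₂`. -/
theorem stmt9 (d : ℕ) (hd : 24 ≤ d) :
    ¬ ∃ r : Finset (Subs d) → ℚ,
      (∀ H : Finset (Subs d), IsProperChain d H → 0 ≤ r H) ∧
      (∑ H ∈ Finset.univ.filter (fun H : Finset (Subs d) => IsProperChain d H),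
        C (r H) * chainMon d H) - Td d ∈ Itot d := by
  rintro ⟨r, hr, hI⟩
  have h0 := phi_Itot d hd _ hI
  have h1 := phi_Td d hd
  rw [map_sub, map_sum] at h0
  have h2 : 0 ≤ ∑ H ∈ Finset.univ.filter (fun H : Finset (Subs d) => IsProperChain d H),
      phi d (C (r H) * chainMon d H) := by
    refine Finset.sum_nonneg (fun H hH => ?_)
    rw [← smul_eq_C_mul, map_smul, smul_eq_mul]
    exact mul_nonneg (hr H (Finset.mem_filter.1 hH).2) (phi_chain d hd H)
  linarith
end

section
/- Let n ≥ 1 and let P ⊂ ℝ^n be a lattice polytope (the convex hull of finitely many points of ℤ^n) of dimension at least 1 which is a lattice generalized permutohedron, i.e., every edge of P is parallel to a vector of the form e_i − e_j for some standard basis vectors e_i, e_j. Suppose p is a polynomial with rational coefficients such that for every positive integer t, p(t) equals the number of points of ℤ^n contained in the dilate t·P. Then the coefficient of t^1 in p is positive. -/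
open Pointwise

open Classical in
theorem chain_euler {α : Type*} [DecidableEq α] (N : Finset (Finset α))
    (J0 : Finset α) (hJ0 : J0 ∈ N) (h : ∀ A ∈ N, A ∪ J0 ∈ N) :
    ∑ C ∈ N.powerset.filter (fun C : Finset (Finset α) =>
      IsChain (· ⊆ ·) (C : Set (Finset α))), (-1 : ℚ) ^ C.card = 0 := by
  let B : Finset (Finset α) → Finset α := fun C => (C.filter (fun A => ¬ J0 ⊆ A)).sup id
  let T : Finset (Finset α) → Finset α := fun C => B C ∪ J0
  let g : Finset (Finset α) → Finset (Finset α) := fun C =>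
    if T C ∈ C then C.erase (T C) else insert (T C) C
  have hJT : ∀ C, J0 ⊆ T C := fun C => Finset.subset_union_right
  have hfe : ∀ C, T (g C) = T C := by
    intro C
    have : (g C).filter (fun A => ¬ J0 ⊆ A) = C.filter (fun A => ¬ J0 ⊆ A) := by
      ext A
      simp only [g]
      split_ifs with hT
      · simp only [Finset.mem_filter, Finset.mem_erase]
        constructor
        · rintro ⟨⟨_, h1⟩, h2⟩; exact ⟨h1, h2⟩
        · rintro ⟨h1, h2⟩
          refine ⟨⟨?_, h1⟩, h2⟩
          rintro rfl
          exact h2 (hJT C)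
      · simp only [Finset.mem_filter, Finset.mem_insert]
        constructor
        · rintro ⟨h1 | h1, h2⟩
          · subst h1; exact absurd (hJT C) h2
          · exact ⟨h1, h2⟩
        · rintro ⟨h1, h2⟩
          exact ⟨Or.inr h1, h2⟩
    simp only [T, B, this]
  have hTN : ∀ C ⊆ N, IsChain (· ⊆ ·) (C : Set (Finset α)) → T C ∈ N := by
    intro C hC hch
    have hB : B C ∈ {A : Finset α | A = ∅ ∨ A ∈ C} := by
      apply Finset.sup_mem
      · left; rfl
      · rintro x (rfl | hx) y (rfl | hy)
        · left; simp
        · right; simpa using hy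
        · right; simpa using hx
        · right
          rcases hch.total hx hy with hh | hh
          · simpa [Finset.union_eq_right.2 hh] using hy
          · simpa [Finset.union_eq_left.2 hh] using hx
      · intro i hi
        right
        exact (Finset.mem_filter.1 hi).1
    rcases hB with hB | hB
    · simp only [T, hB, Finset.empty_union]; exact hJ0
    · exact h _ (hC hB)
  have hcomp : ∀ C : Finset (Finset α), IsChain (· ⊆ ·) (C : Set (Finset α)) →
      ∀ A ∈ C, T C ⊆ A ∨ A ⊆ T C := by
    intro C hch A hA
    by_cases hJ : J0 ⊆ A
    · left
      apply Finset.union_subset _ hJ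
      apply Finset.sup_le
      intro A' hA'
      rw [Finset.mem_filter] at hA'
      rcases hch.total hA hA'.1 with hh | hh
      · exact absurd (hJ.trans hh) hA'.2
      · exact hh
    · right
      have : A ⊆ B C := Finset.le_sup (f := id) (Finset.mem_filter.2 ⟨hA, hJ⟩)
      exact this.trans Finset.subset_union_left
  apply Finset.sum_involution (fun C _ => g C)
  · intro C hC
    simp only [g]
    split_ifs with hT
    · have := Finset.card_erase_add_one hT
      rw [← this, pow_succ]; ring
    · rw [Finset.card_insert_of_notMem hT, pow_succ]; ring
  · intro C hC _ heq
    simp only [g] at heq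
    split_ifs at heq with hT
    · exact (Finset.erase_ne_self.2 hT) heq
    · exact (Finset.insert_ne_self.2 hT) heq
  · intro C hC
    simp only [Finset.mem_filter, Finset.mem_powerset] at hC ⊢
    simp only [g]
    split_ifs with hT
    · exact ⟨(Finset.erase_subset _ _).trans hC.1,
        hC.2.mono (by simp)⟩
    · refine ⟨Finset.insert_subset (hTN C hC.1 hC.2) hC.1, ?_⟩
      rw [Finset.coe_insert]
      exact hC.2.insert (fun A hA _ => hcomp C hC.2 A hA)
  · intro C hC
    have := hfe C
    change (if T (g C) ∈ g C then (g C).erase (T (g C)) else insert (T (g C)) (g C)) = C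
    rw [this]
    by_cases hT : T C ∈ C
    · have hg : g C = C.erase (T C) := by simp only [g, if_pos hT]
      rw [hg]; simp [hT]
    · have hg : g C = insert (T C) C := by simp only [g, if_neg hT]
      rw [hg]; simp [hT]

theorem faulhaber {σ : Type*} (Q : Polynomial (MvPolynomial σ ℚ)) :
    ∃ A : Polynomial (MvPolynomial σ ℚ), ∀ (z : σ → ℚ) (N : ℕ),
      ∑ k ∈ Finset.range N, (Q.map (MvPolynomial.eval z)).eval (k : ℚ)
        = (A.map (MvPolynomial.eval z)).eval (N : ℚ) := by
  induction Q using Polynomial.induction_on' with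
  | add p q hp hq =>
    obtain ⟨A, hA⟩ := hp
    obtain ⟨B, hB⟩ := hq
    refine ⟨A + B, fun z N => ?_⟩
    simp only [Polynomial.map_add, Polynomial.eval_add, Finset.sum_add_distrib, hA, hB]
  | monomial k a =>
    let F : Polynomial ℚ := ∑ i ∈ Finset.range (k + 1),
      Polynomial.C (bernoulli i * ((k + 1).choose i : ℚ) / (k + 1 : ℚ)) * Polynomial.X ^ (k + 1 - i)
    have hF : ∀ N : ℕ, ∑ j ∈ Finset.range N, (j : ℚ) ^ k = F.eval (N : ℚ) := by
      intro N
      rw [sum_range_pow]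
      simp only [F, Polynomial.eval_finsetSum, Polynomial.eval_mul, Polynomial.eval_C,
        Polynomial.eval_pow, Polynomial.eval_X]
      apply Finset.sum_congr rfl
      intro i _
      ring
    refine ⟨Polynomial.C a * F.map MvPolynomial.C, fun z N => ?_⟩
    have h1 : (F.map (MvPolynomial.C (σ := σ))).map (MvPolynomial.eval z) = F := by
      rw [Polynomial.map_map]
      convert Polynomial.map_id
      ext
      simp
    simp only [Polynomial.map_monomial, Polynomial.eval_monomial, Polynomial.map_mul, h1,
      Polynomial.map_C, Polynomial.eval_mul, Polynomial.eval_C, ← hF, Finset.mul_sum]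

open Classical in
noncomputable def cnt (m : ℕ) (c : Fin m → Prop) (Z : Fin m → ℕ) (T Y : ℕ) : ℕ :=
  ∑ x ∈ Fintype.piFinset (fun _ : Fin m => Finset.range (T + 1)),
    if (Y + ∑ k, x k = T ∧ ∀ i, c i → Y + ∑ k, (if k ≤ i then x k else 0) < Z i) then 1 else 0

open Classical in
theorem cnt_succ (m : ℕ) (c : Fin (m + 1) → Prop) (Z : Fin (m + 1) → ℕ) (T Y : ℕ) :
    cnt (m + 1) c Z T Y = ∑ k ∈ Finset.range (T + 1),
      if (c 0 → Y + k < Z 0) then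
        cnt m (fun i => c i.succ) (fun i => Z i.succ) T (Y + k) else 0 := by
  unfold cnt
  have : ∀ k, (if (c 0 → Y + k < Z 0) then
        (∑ x ∈ Fintype.piFinset (fun _ : Fin m => Finset.range (T + 1)),
    if (Y + k + ∑ k, x k = T ∧ ∀ i, c (Fin.succ i) → Y + k + ∑ k, (if k ≤ i then x k else 0) < Z (Fin.succ i)) then 1 else 0) else 0) =
      ∑ x ∈ Fintype.piFinset (fun _ : Fin m => Finset.range (T + 1)), if (c 0 → Y + k < Z 0) ∧ (Y + k + ∑ k, x k = T ∧ ∀ i, c (Fin.succ i) → Y + k + ∑ k, (if k ≤ i then x k else 0) < Z (Fin.succ i)) then 1 else 0 := by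
    intro k
    split_ifs with h
    · apply Finset.sum_congr rfl
      intro x _
      simp only [eq_true h, true_and]
    · simp [h]
  simp only [this]
  rw [← Finset.sum_product']
  symm
  apply Finset.sum_nbij' (fun a : ℕ × (Fin m → ℕ) => (Fin.cons a.1 a.2 : Fin (m + 1) → ℕ))
    (fun x => (x 0, Fin.tail x))
  · intro a ha
    simp only [Finset.mem_product, Fintype.mem_piFinset] at ha
    simp only [Fintype.mem_piFinset]
    intro i
    refine Fin.cases ?_ ?_ i
    · simpa using ha.1
    · intro j; simpa using ha.2 j
  · intro x hx
    simp only [Fintype.mem_piFinset] at hx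
    simp only [Finset.mem_product, Fintype.mem_piFinset]
    exact ⟨hx 0, fun j => hx j.succ⟩
  · intro a _; simp
  · intro x _; simp
  · intro a _
    simp only [Fin.forall_fin_succ, Fin.sum_univ_succ, Fin.cons_zero, Fin.cons_succ,
      Fin.succ_le_succ_iff, Fin.zero_le, if_true]
    congr 1
    simp [add_assoc]
    tauto

theorem cnt_poly {σ : Type*} (u : σ) : ∀ (m : ℕ) (J : Fin (m + 1) → σ) (c : Fin (m + 1) → Prop),
    ∃ (e : (σ → ℕ) → ℕ) (E : MvPolynomial σ ℚ) (Q : Polynomial (MvPolynomial σ ℚ)),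
      ∀ z : σ → ℕ, Monotone (z ∘ J) → (∀ i, z (J i) ≤ z u) →
        MvPolynomial.eval (fun s => (z s : ℚ)) E = e z ∧ z (J 0) ≤ e z ∧ e z ≤ z u + 1 ∧
        ∀ Y, (e z ≤ Y → cnt (m + 1) c (z ∘ J) (z u) Y = 0) ∧
          (Y ≤ e z → Y ≤ z u → (cnt (m + 1) c (z ∘ J) (z u) Y : ℚ) =
            (Q.map (MvPolynomial.eval (fun s => (z s : ℚ)))).eval (Y : ℚ)) := by
  classical
  intro m
  induction m with
  | zero =>
    intro J c
    have key : ∀ (z : σ → ℕ), (∀ i, z (J i) ≤ z u) → ∀ Y, cnt 1 c (z ∘ J) (z u) Y =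
        if (¬ c 0 ∧ Y ≤ z u) then 1 else 0 := by
      intro z hz Y
      rw [cnt_succ]
      simp only [cnt, Finset.univ_eq_empty, Finset.sum_empty, IsEmpty.forall_iff, and_true,
        add_zero, Function.comp]
      have h0 := hz 0
      by_cases hc : c 0
      · simp only [hc, not_true, false_and, if_false, true_implies]
        apply Finset.sum_eq_zero
        intro k _
        simp
        omega
      · simp only [hc, not_false_eq_true, true_and, false_implies, if_true]
        split_ifs with hY
        · rw [Finset.sum_eq_single (z u - Y)]
          · simp [Nat.add_sub_of_le hY]
          · intro k _ hk; simp; omega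
          · simp
        · apply Finset.sum_eq_zero
          intro k _
          simp
          omega
    refine ⟨fun z => z u + 1, MvPolynomial.X u + 1, if c 0 then 0 else 1, ?_⟩
    intro z hmono hz
    refine ⟨by simp, (hz 0).trans (Nat.le_succ _), le_rfl, fun Y => ⟨fun h => ?_, fun h h2 => ?_⟩⟩
    · rw [key z hz]; rw [if_neg]; simp only at h; omega
    · rw [key z hz]
      by_cases hc : c 0 <;> simp [hc, h2]
  | succ m ih =>
    intro J c
    obtain ⟨e', E', Q', h'⟩ := ih (fun i => J i.succ) (fun i => c i.succ)
    obtain ⟨A, hA⟩ := faulhaber Q'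
    let e : (σ → ℕ) → ℕ := fun z => if c 0 then z (J 0) else e' z
    let E : MvPolynomial σ ℚ := if c 0 then MvPolynomial.X (J 0) else E'
    refine ⟨e, E, Polynomial.C (A.eval E) - A, ?_⟩
    intro z hmono hz
    obtain ⟨h1, h2, h3, h4⟩ := h' z (fun a b hab => hmono (Fin.succ_le_succ_iff.2 hab))
      (fun i => hz i.succ)
    have h01 : z (J 0) ≤ z (J (Fin.succ 0)) := hmono (Fin.zero_le _)
    have hE : MvPolynomial.eval (fun s => (z s : ℚ)) E = e z := by
      by_cases hc : c 0 <;> simp [E, e, hc, h1]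
    have h0e : z (J 0) ≤ e z := by
      by_cases hc : c 0 <;> simp [e, hc]; exact h01.trans h2
    have hee : e z ≤ e' z := by
      by_cases hc : c 0 <;> simp [e, hc]; exact h01.trans h2
    have heu : e z ≤ z u + 1 := hee.trans h3
    let f : ℕ → ℕ := fun y => if (c 0 → y < z (J 0)) then
      cnt (m + 1) (fun i => c i.succ) (fun i => z (J i.succ)) (z u) y else 0
    have hf0 : ∀ y, e z ≤ y → f y = 0 := by
      intro y hy
      simp only [f]
      by_cases hc : c 0
      · simp only [e, hc, if_true] at hy
        rw [if_neg]; simp [hc, hy]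
      · simp only [e, hc, if_false] at hy
        simp only [hc, false_implies, if_true]
        exact (h4 y).1 hy
    have hf1 : ∀ y, y < e z → (f y : ℚ) =
        (Q'.map (MvPolynomial.eval (fun s => (z s : ℚ)))).eval (y : ℚ) := by
      intro y hy
      have : (c 0 → y < z (J 0)) := by
        intro hc
        simpa only [e, hc, if_true] using hy
      simp only [f]
      rw [if_pos this]
      exact (h4 y).2 (by omega) (by omega)
    have hrec : ∀ Y, cnt (m + 1 + 1) c (z ∘ J) (z u) Y =
        ∑ k ∈ Finset.range (z u + 1), f (Y + k) := by
      intro Y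
      rw [cnt_succ]
      rfl
    refine ⟨hE, h0e, heu, fun Y => ⟨fun hY => ?_, fun hY hYu => ?_⟩⟩
    · rw [hrec]
      apply Finset.sum_eq_zero
      intro k _
      exact hf0 _ (by omega)
    · rw [hrec]
      have : ∑ k ∈ Finset.range (z u + 1), f (Y + k) = ∑ k ∈ Finset.range (e z - Y), f (Y + k) := by
        symm
        apply Finset.sum_subset
        · apply Finset.range_subset_range.2; omega
        · intro k _ hk
          apply hf0
          simp at hk
          omega
      rw [this]
      rw [← Finset.sum_Ico_eq_sum_range, Nat.cast_sum]
      rw [Finset.sum_congr rfl (fun y hy => hf1 y (Finset.mem_Ico.1 hy).2)]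
      rw [Finset.sum_Ico_eq_sub _ hY, hA, hA]
      simp only [Polynomial.map_sub, Polynomial.map_C, Polynomial.eval_sub, Polynomial.eval_C]
      rw [← hE, ← Polynomial.eval_map_apply]

theorem chain_flag (m : ℕ) (C : Finset (Finset (Fin (m + 1))))
    (hC : IsChain (· ⊆ ·) (C : Set (Finset (Fin (m + 1))))) :
    ∃ σ : Equiv.Perm (Fin (m + 1)), ∀ J ∈ C, J.Nonempty →
      ∃ i, J = (Finset.univ.filter (fun k => k ≤ i)).map σ.toEmbedding := by
  classical
  let r : Fin (m + 1) → ℕ := fun i => (C.filter (fun J => i ∉ J)).card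
  refine ⟨Tuple.sort r, ?_⟩
  have hmono := Tuple.monotone_sort r
  set σ := Tuple.sort r
  intro J hJ hne
  have hlt : ∀ a b, a ∈ J → b ∉ J → r a < r b := by
    intro a b ha hb
    apply Finset.card_lt_card
    rw [Finset.ssubset_iff_of_subset]
    · exact ⟨J, by simp [hJ, hb], by simp [ha]⟩
    · intro K hK
      simp only [Finset.mem_filter] at hK ⊢
      refine ⟨hK.1, fun hbK => ?_⟩
      rcases hC.total hJ hK.1 with h | h
      · exact hK.2 (h ha)
      · exact hb (h hbK)
  let S : Finset (Fin (m + 1)) := Finset.univ.filter (fun k => σ k ∈ J)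
  have hS : S.Nonempty := by
    obtain ⟨j, hj⟩ := hne
    exact ⟨σ.symm j, by simp [S, hj]⟩
  refine ⟨S.max' hS, ?_⟩
  have hmax : σ (S.max' hS) ∈ J := (Finset.mem_filter.1 (S.max'_mem hS)).2
  ext j
  simp only [Finset.mem_map, Finset.mem_filter, Finset.mem_univ, true_and, Equiv.coe_toEmbedding]
  constructor
  · intro hj
    exact ⟨σ.symm j, S.le_max' _ (by simp [S, hj]), by simp⟩
  · rintro ⟨k, hk, rfl⟩
    by_contra hkJ
    have h1 := hlt _ _ hmax hkJ
    have h2 := hmono hk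
    simp only [Function.comp] at h2
    omega

open Classical in
theorem chain_count (m : ℕ) (C : Finset (Finset (Fin (m + 1))))
    (hC : IsChain (· ⊆ ·) (C : Set (Finset (Fin (m + 1))))) :
    ∃ G : MvPolynomial (Finset (Fin (m + 1))) ℚ, ∀ z : Finset (Fin (m + 1)) → ℕ,
      z ∅ = 0 → Monotone z →
      ((∑ x ∈ Fintype.piFinset (fun _ : Fin (m + 1) => Finset.range (z Finset.univ + 1)),
        if (∑ i, x i = z Finset.univ ∧ ∀ J ∈ C, ∑ i ∈ J, x i < z J) then 1 else 0 : ℕ) : ℚ)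
        = MvPolynomial.eval (fun s => (z s : ℚ)) G := by
  by_cases h0 : ∅ ∈ C
  · refine ⟨0, fun z hz0 hz => ?_⟩
    rw [Finset.sum_eq_zero]
    · simp
    · intro x _
      rw [if_neg]
      rintro ⟨_, h⟩
      have := h ∅ h0
      simp [hz0] at this
  obtain ⟨σ, hσ⟩ := chain_flag m C hC
  let Jf : Fin (m + 1) → Finset (Fin (m + 1)) := fun i =>
    (Finset.univ.filter (fun k => k ≤ i)).map σ.toEmbedding
  obtain ⟨e, E, Q, h⟩ := cnt_poly (Finset.univ : Finset (Fin (m + 1))) m Jf (fun i => Jf i ∈ C)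
  refine ⟨Q.eval 0, fun z hz0 hz => ?_⟩
  have hJf : Monotone Jf := by
    intro a b hab
    apply Finset.map_subset_map.2
    intro k hk
    simp only [Finset.mem_filter, Finset.mem_univ, true_and] at hk ⊢
    exact hk.trans hab
  obtain ⟨-, -, -, h4⟩ := h z (hz.comp hJf) (fun i => hz (Finset.subset_univ _))
  have h5 := (h4 0).2 (Nat.zero_le _) (Nat.zero_le _)
  have h6 : (Q.map (MvPolynomial.eval (fun s => (z s : ℚ)))).eval ((0 : ℕ) : ℚ) =
      MvPolynomial.eval (fun s => (z s : ℚ)) (Q.eval 0) := by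
    rw [← Polynomial.eval_map_apply]; simp
  rw [← h6, ← h5]
  congr 1
  unfold cnt
  have hpre : ∀ (x : Fin (m + 1) → ℕ) i, ∑ j ∈ Jf i, x j = ∑ k, if k ≤ i then x (σ k) else 0 := by
    intro x i
    simp only [Jf, Finset.sum_map, Finset.sum_filter, Equiv.coe_toEmbedding]
  apply Finset.sum_nbij' (fun x => x ∘ σ) (fun y => y ∘ σ.symm)
  · intro x hx
    simp only [Fintype.mem_piFinset] at hx ⊢
    intro i; exact hx _
  · intro x hx
    simp only [Fintype.mem_piFinset] at hx ⊢
    intro i; exact hx _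
  · intro x _; ext; simp
  · intro x _; ext; simp
  · intro x _
    simp only [Function.comp, zero_add, ← hpre, Equiv.sum_comp σ x]
    congr 1
    apply propext
    apply and_congr Iff.rfl
    constructor
    · intro hh i hi
      exact hh _ hi
    · intro hh J hJ
      have hne : J.Nonempty := by
        rw [Finset.nonempty_iff_ne_empty]; rintro rfl; exact h0 hJ
      obtain ⟨i, hi⟩ := hσ J hJ hne
      have := hh i (by rw [← show J = Jf i from hi]; exact hJ)
      rwa [← show J = Jf i from hi] at this

open Classical in
noncomputable def latc {n : ℕ} (z : Finset (Fin n) → ℕ) : ℕ :=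
  ((Fintype.piFinset (fun _ : Fin n => Finset.range (z Finset.univ + 1))).filter
    (fun x => ∑ i, x i = z Finset.univ ∧ ∀ J, z J ≤ ∑ i ∈ J, x i)).card

structure Good {n : ℕ} (z : Finset (Fin n) → ℕ) : Prop where
  empty : z ∅ = 0
  mono : Monotone z
  super : ∀ A B, z A + z B ≤ z (A ∪ B) + z (A ∩ B)

theorem latc_poly (m : ℕ) : ∃ G : MvPolynomial (Finset (Fin (m + 1))) ℚ,
    ∀ z : Finset (Fin (m + 1)) → ℕ, Good z →
      (latc z : ℚ) = MvPolynomial.eval (fun s => (z s : ℚ)) G := by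
  classical
  choose! G hG using chain_count m
  let Ch : Finset (Finset (Finset (Fin (m + 1)))) :=
    Finset.univ.filter (fun C => IsChain (· ⊆ ·) (C : Set (Finset (Fin (m + 1)))))
  refine ⟨∑ C ∈ Ch, (-1) ^ C.card * G C, fun z hz => ?_⟩
  rw [map_sum]
  have h1 : ∀ C ∈ Ch, MvPolynomial.eval (fun s => (z s : ℚ)) ((-1) ^ C.card * G C) =
      ∑ x ∈ Fintype.piFinset (fun _ : Fin (m + 1) => Finset.range (z Finset.univ + 1)),
        if (∑ i, x i = z Finset.univ ∧ ∀ J ∈ C, ∑ i ∈ J, x i < z J) then (-1 : ℚ) ^ C.card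
        else 0 := by
    intro C hC
    rw [map_mul, ← hG C (Finset.mem_filter.1 hC).2 z hz.empty hz.mono]
    push_cast
    rw [Finset.mul_sum]
    simp
  rw [Finset.sum_congr rfl h1, Finset.sum_comm]
  unfold latc
  rw [Finset.card_filter, Nat.cast_sum]
  apply Finset.sum_congr rfl
  intro x _
  by_cases hx : ∑ i, x i = z Finset.univ
  swap
  · simp [hx]
  simp only [hx, true_and]
  let N : Finset (Finset (Fin (m + 1))) := Finset.univ.filter (fun J => ∑ i ∈ J, x i < z J)
  have h2 : ∑ C ∈ Ch, (if (∀ J ∈ C, ∑ i ∈ J, x i < z J) then (-1 : ℚ) ^ C.card else 0) =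
      ∑ C ∈ N.powerset.filter (fun C : Finset (Finset (Fin (m + 1))) =>
        IsChain (· ⊆ ·) (C : Set (Finset (Fin (m + 1))))), (-1 : ℚ) ^ C.card := by
    rw [← Finset.sum_filter]
    apply Finset.sum_congr _ (fun _ _ => rfl)
    ext C
    simp only [Ch, N, Finset.mem_filter, Finset.mem_univ, true_and, Finset.mem_powerset,
      Finset.subset_iff]
    exact and_comm
  rw [h2]
  by_cases hN : N = ∅
  · have : ∀ J, z J ≤ ∑ i ∈ J, x i := by
      intro J
      by_contra hJ
      have : J ∈ N := by simp only [N, Finset.mem_filter, Finset.mem_univ, true_and]; omega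
      simp [hN] at this
    rw [if_pos this, hN]
    simp [Finset.filter_singleton]
  · have hN' : N.Nonempty := Finset.nonempty_iff_ne_empty.2 hN
    obtain ⟨J1, hJ1⟩ := hN'
    have hJ1' := (Finset.mem_filter.1 hJ1).2
    rw [if_neg (by push Not; exact ⟨J1, hJ1'⟩)]
    let d : Finset (Fin (m + 1)) → ℤ := fun J => ∑ i ∈ J, (x i : ℤ) - z J
    have hdN : ∀ J, J ∈ N ↔ d J < 0 := by
      intro J
      simp only [N, d, Finset.mem_filter, Finset.mem_univ, true_and]
      rw [sub_neg]
      exact_mod_cast Iff.rfl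
    obtain ⟨J0, -, hJ0⟩ := Finset.exists_min_image (Finset.univ) d ⟨J1, Finset.mem_univ _⟩
    rw [Nat.cast_zero]
    symm
    refine chain_euler N J0 ?_ ?_
    · rw [hdN]
      exact lt_of_le_of_lt (hJ0 J1 (Finset.mem_univ _)) ((hdN _).1 hJ1)
    · intro A hA
      rw [hdN] at hA ⊢
      have h3 := hJ0 (A ∩ J0) (Finset.mem_univ _)
      have h4 := hz.super A J0
      have h5 := Finset.sum_union_inter (s₁ := A) (s₂ := J0) (f := fun i => (x i : ℤ))
      simp only [d] at h3 hA ⊢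
      zify at h4
      linarith

theorem eval_aeval_scale {σ : Type*} (G : MvPolynomial σ ℚ) (z : σ → ℚ) (t : ℚ) :
    (MvPolynomial.aeval (fun s => Polynomial.C (z s) * Polynomial.X) G : Polynomial ℚ).eval t
      = MvPolynomial.eval (fun s => t * z s) G := by
  induction G using MvPolynomial.induction_on with
  | C a => simp
  | add p q hp hq => simp only [map_add, Polynomial.eval_add, hp, hq]
  | mul_X p s hp =>
    simp only [map_mul, Polynomial.eval_mul, hp, MvPolynomial.aeval_X, MvPolynomial.eval_X,
      Polynomial.eval_C, Polynomial.eval_X]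
    ring

theorem lin_part {σ : Type*} [Fintype σ] (G : MvPolynomial σ ℚ) :
    ∃ γ : σ → ℚ, ∀ z : σ → ℚ,
      (MvPolynomial.aeval (fun s => Polynomial.C (z s) * Polynomial.X) G : Polynomial ℚ).coeff 1
        = ∑ s, γ s * z s := by
  classical
  induction G using MvPolynomial.induction_on with
  | C a => exact ⟨0, fun z => by simp [MvPolynomial.algHom_C]⟩
  | add p q hp hq =>
    obtain ⟨a, ha⟩ := hp
    obtain ⟨b, hb⟩ := hq
    exact ⟨a + b, fun z => by simp [ha, hb, add_mul, Finset.sum_add_distrib]⟩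
  | mul_X p s _ =>
    refine ⟨fun s' => if s' = s then MvPolynomial.constantCoeff p else 0, fun z => ?_⟩
    rw [map_mul, MvPolynomial.aeval_X, ← mul_assoc, Polynomial.coeff_mul_X, Polynomial.coeff_mul_C]
    have : (MvPolynomial.aeval (fun s => Polynomial.C (z s) * Polynomial.X) p : Polynomial ℚ).coeff 0
        = MvPolynomial.constantCoeff p := by
      rw [Polynomial.coeff_zero_eq_eval_zero, eval_aeval_scale]
      simp only [zero_mul]
      rw [MvPolynomial.eval_zero']
    rw [this]
    simp

/-- universal linear functional -/
theorem latc_linear (m : ℕ) : ∃ γ : Finset (Fin (m + 1)) → ℚ,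
    ∀ z : Finset (Fin (m + 1)) → ℕ, Good z → ∀ p : Polynomial ℚ,
      (∀ t : ℕ, 1 ≤ t → p.eval (t : ℚ) = (latc (fun J => t * z J) : ℚ)) →
      p.coeff 1 = ∑ J, γ J * (z J : ℚ) := by
  obtain ⟨G, hG⟩ := latc_poly m
  obtain ⟨γ, hγ⟩ := lin_part G
  refine ⟨γ, fun z hz p hp => ?_⟩
  rw [← hγ]
  congr 1
  apply Polynomial.eq_of_infinite_eval_eq
  apply Set.Infinite.mono (s := (fun t : ℕ => (t : ℚ)) '' (Set.Ici 1))
  · rintro _ ⟨t, ht, rfl⟩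
    have hg : Good (fun J => t * z J) := by
      refine ⟨by simp [hz.empty], fun A B h => Nat.mul_le_mul_left _ (hz.mono h), fun A B => ?_⟩
      simp only [← Nat.mul_add]
      exact Nat.mul_le_mul_left _ (hz.super A B)
    simp only [Set.mem_ofPred_eq]
    rw [hp t ht, hG _ hg]
    rw [eval_aeval_scale]
    simp
  · exact (Set.Ici_infinite 1).image (Nat.cast_injective.injOn)

theorem exists_choose_poly (k : ℕ) : ∃ p : Polynomial ℚ,
    (∀ t : ℕ, p.eval (t : ℚ) = ((t + k).choose k : ℚ)) ∧ p.coeff 0 = 1 ∧ p.coeff 1 = harmonic k := by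
  induction k with
  | zero => exact ⟨1, by simp, by simp, by simp [Polynomial.coeff_one]⟩
  | succ k ih =>
    obtain ⟨p, h1, h2, h3⟩ := ih
    have hk : ((k : ℚ) + 1) ≠ 0 := by positivity
    refine ⟨(p * Polynomial.X + p * Polynomial.C ((k : ℚ) + 1)) * Polynomial.C (((k : ℚ) + 1)⁻¹),
      fun t => ?_, ?_, ?_⟩
    · simp only [Polynomial.eval_mul, Polynomial.eval_add, Polynomial.eval_X, Polynomial.eval_C, h1]
      have := Nat.add_one_mul_choose_eq (t + k) k
      have h : ((t : ℚ) + k + 1) * ((t + k).choose k : ℚ) = ((t + k + 1).choose (k + 1) : ℚ) * (k + 1) := by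
        exact_mod_cast this
      rw [← add_assoc]
      field_simp
      linarith
    · rw [Polynomial.coeff_mul_C, Polynomial.coeff_add, Polynomial.coeff_mul_C]
      simp [h2, hk]
    · rw [Polynomial.coeff_mul_C, Polynomial.coeff_add, Polynomial.coeff_mul_C,
        Polynomial.coeff_mul_X, h2, h3, harmonic_succ]
      push_cast
      field_simp
      ring

theorem latc_simplex {n : ℕ} (I : Finset (Fin n)) (t : ℕ) :
    latc (fun J => t * (if I ⊆ J then 1 else 0)) = (Finset.piAntidiag I t).card := by
  classical
  unfold latc
  congr 1
  ext x
  simp only [Finset.subset_univ, if_true, mul_one, Finset.mem_filter, Fintype.mem_piFinset,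
    Finset.mem_range, Finset.mem_piAntidiag]
  constructor
  · rintro ⟨-, h1, h2⟩
    have h3 := h2 I
    simp only [Finset.Subset.refl, if_true, mul_one] at h3
    have h4 := Finset.sum_add_sum_compl I x
    refine ⟨by change ∑ i ∈ I, x i = t; omega, fun i hi => ?_⟩
    by_contra hiI
    have h5 := Finset.single_le_sum (f := x) (fun _ _ => Nat.zero_le _) (Finset.mem_compl.2 hiI)
    omega
  · rintro ⟨h1, h2⟩
    have h1 : ∑ i ∈ I, x i = t := h1
    have h4 := Finset.sum_add_sum_compl I x
    have h5 : ∑ i ∈ Iᶜ, x i = 0 := by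
      apply Finset.sum_eq_zero
      intro i hi
      by_contra hne
      exact (Finset.mem_compl.1 hi) (h2 i hne)
    refine ⟨fun i => ?_, by omega, fun J => ?_⟩
    · have := Finset.single_le_sum (f := x) (fun _ _ => Nat.zero_le _) (Finset.mem_univ i)
      omega
    · split_ifs with hIJ
      · have := Finset.sum_le_sum_of_subset (f := x) hIJ
        omega
      · simp

theorem good_simplex {n : ℕ} (I : Finset (Fin n)) (hI : I.Nonempty) :
    Good (fun J => if I ⊆ J then 1 else 0) := by
  refine ⟨?_, ?_, ?_⟩
  · simp [hI.ne_empty]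
  · intro A B h
    have h : A ⊆ B := h
    simp only
    split_ifs with h1 h2
    · exact le_rfl
    · exact absurd (h1.trans h) h2
    · simp
    · simp
  · intro A B
    have h1 : I ⊆ A → I ⊆ A ∪ B := fun h => h.trans Finset.subset_union_left
    have h2 : I ⊆ B → I ⊆ A ∪ B := fun h => h.trans Finset.subset_union_right
    simp only [Finset.subset_inter_iff]
    by_cases hA : I ⊆ A <;> by_cases hB : I ⊆ B <;> simp [hA, hB, h1, h2] 

theorem latc_point {n : ℕ} (x : Fin n → ℕ) (t : ℕ) :
    latc (fun J => t * ∑ i ∈ J, x i) = 1 := by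
  classical
  unfold latc
  rw [Finset.card_eq_one]
  refine ⟨fun i => t * x i, ?_⟩
  ext y
  simp only [Finset.mem_filter, Fintype.mem_piFinset, Finset.mem_range, Finset.mem_singleton]
  constructor
  · rintro ⟨-, h1, h2⟩
    ext i
    have h3 := h2 {i}
    have h4 := h2 {i}ᶜ
    have h5 := Finset.sum_add_sum_compl {i} y
    have h6 := Finset.sum_add_sum_compl {i} x
    simp only [Finset.sum_singleton] at h3 h4 h5 h6
    rw [← h6, mul_add] at h1
    omega
  · rintro rfl
    refine ⟨fun i => ?_, by rw [Finset.mul_sum], fun J => by rw [Finset.mul_sum]⟩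
    have := Finset.single_le_sum (f := x) (fun _ _ => Nat.zero_le _) (Finset.mem_univ i)
    have := Nat.mul_le_mul_left t this
    simp only
    omega

theorem good_point {n : ℕ} (x : Fin n → ℕ) : Good (fun J => ∑ i ∈ J, x i) :=
  ⟨by simp, fun _ _ h => Finset.sum_le_sum_of_subset h, fun _ _ =>
    (Finset.sum_union_inter).symm.le⟩

theorem gamma_neg {m : ℕ} (γ : Finset (Fin (m + 1)) → ℚ)
    (h : ∀ I : Finset (Fin (m + 1)), I.Nonempty →
      ∑ J, (if I ⊆ J then γ J else 0) = harmonic (I.card - 1)) :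
    ∀ J, J ≠ ∅ → J ≠ Finset.univ → γ J < 0 := by
  classical
  let S : Finset (Fin (m + 1)) → Finset (Fin (m + 1)) → ℚ := fun I A =>
    ∑ J, (if I ⊆ J ∧ Disjoint J A then γ J else 0)
  have hS0 : ∀ I, I.Nonempty → S I ∅ = harmonic (I.card - 1) := by
    intro I hI
    rw [← h I hI]
    simp [S]
  have hSi : ∀ I A b, S I (insert b A) = S I A - S (insert b I) A := by
    intro I A b
    simp only [S]
    rw [← Finset.sum_sub_distrib]
    apply Finset.sum_congr rfl
    intro J _
    by_cases h1 : I ⊆ J <;> by_cases h2 : Disjoint J A <;> by_cases h3 : b ∈ J <;>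
      simp [h1, h2, h3, Finset.insert_subset_iff, Finset.disjoint_insert_right]
  have main : ∀ a i (A I : Finset (Fin (m + 1))), A.card = a + 1 → I.card = i + 1 → Disjoint I A →
      S I A = - ((i.factorial * a.factorial : ℚ) / ((i + a + 1).factorial : ℚ)) := by
    intro a
    induction a with
    | zero =>
      intro i A I hA hI hd
      obtain ⟨b, rfl⟩ := Finset.card_eq_one.1 hA
      have hb : b ∉ I := by simpa using hd
      have hIne : I.Nonempty := by rw [← Finset.card_pos]; omega
      have := hSi I ∅ b
      rw [hS0 I hIne, hS0 _ (Finset.insert_nonempty _ _), Finset.card_insert_of_notMem hb, hI] at this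
      rw [show ({b} : Finset (Fin (m+1))) = insert b ∅ by simp, this]
      simp only [Nat.add_sub_cancel, harmonic_succ, Nat.factorial_succ, add_zero,
        Nat.factorial_zero]
      have : (i.factorial : ℚ) ≠ 0 := by positivity
      push_cast
      field_simp
      ring
    | succ a ih =>
      intro i A I hA hI hd
      obtain ⟨b, A', hb, rfl, hA'⟩ := Finset.card_eq_succ.1 hA
      rw [Finset.disjoint_insert_right] at hd
      rw [hSi, ih i A' I hA' hI hd.2, ih (i + 1) A' (insert b I) hA'
        (by rw [Finset.card_insert_of_notMem hd.1, hI])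
        (by rw [Finset.disjoint_insert_left]; exact ⟨hb, hd.2⟩)]
      rw [show i + 1 + a + 1 = (i + a + 1) + 1 by ring, show i + (a + 1) + 1 = (i + a + 1) + 1 by ring]
      simp only [Nat.factorial_succ (i + a + 1), Nat.factorial_succ i, Nat.factorial_succ a]
      have : ((i + a + 1).factorial : ℚ) ≠ 0 := by positivity
      push_cast
      field_simp
      ring
  intro J h0 h1
  have hJ : 0 < J.card := Finset.card_pos.2 (Finset.nonempty_iff_ne_empty.2 h0)
  have hJc : 0 < Jᶜ.card := Finset.card_pos.2 (by
    rw [Finset.nonempty_iff_ne_empty]; simpa using h1)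
  have h2 := main (Jᶜ.card - 1) (J.card - 1) Jᶜ J (by omega) (by omega) disjoint_compl_right
  have h3 : S J Jᶜ = γ J := by
    simp only [S]
    rw [Finset.sum_eq_single J]
    · simp [disjoint_compl_right]
    · intro K _ hK
      rw [if_neg]
      rintro ⟨h4, h5⟩
      rw [disjoint_compl_right_iff] at h5
      exact hK (le_antisymm h5 h4)
    · simp
  rw [← h3, h2]
  simp only [neg_neg_iff_pos]
  positivity

theorem latc_positive (m : ℕ) (z : Finset (Fin (m + 1)) → ℕ) (hz : Good z)
    (p : Polynomial ℚ)
    (hp : ∀ t : ℕ, 1 ≤ t → p.eval (t : ℚ) = (latc (fun J => t * z J) : ℚ))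
    (x : Fin (m + 1) → ℕ) (hx : ∀ J, z J ≤ ∑ i ∈ J, x i) (hxu : ∑ i, x i = z Finset.univ)
    (J0 : Finset (Fin (m + 1))) (hJ0 : z J0 < ∑ i ∈ J0, x i) : 0 < p.coeff 1 := by
  obtain ⟨γ, hγ⟩ := latc_linear m
  have hneg : ∀ J, J ≠ ∅ → J ≠ Finset.univ → γ J < 0 := by
    apply gamma_neg
    intro I hI
    obtain ⟨q, h1, -, h3⟩ := exists_choose_poly (I.card - 1)
    rw [← h3, hγ _ (good_simplex I hI) q]
    · simp
    · intro t ht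
      rw [latc_simplex, h1]
      have : 0 < I.card := Finset.card_pos.2 hI
      have hc : (Finset.piAntidiag I t).card = (I.finsuppAntidiag t).card := by
        symm
        apply Finset.card_bij (fun (f : Fin (m + 1) →₀ ℕ) _ => (f : Fin (m + 1) → ℕ))
        · intro f hf
          rw [Finset.mem_finsuppAntidiag] at hf
          rw [Finset.mem_piAntidiag]
          exact ⟨hf.1, fun i hi => hf.2 (by simpa using hi)⟩
        · intro f _ g _ hfg
          exact DFunLike.coe_injective hfg
        · intro f hf
          rw [Finset.mem_piAntidiag] at hf
          refine ⟨Finsupp.equivFunOnFinite.symm f, ?_, rfl⟩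
          rw [Finset.mem_finsuppAntidiag]
          exact ⟨hf.1, fun i hi => hf.2 i (by simpa using hi)⟩
      rw [hc, Finset.card_finsuppAntidiag_nat_eq_choose,
        show I.card + t - 1 = t + (I.card - 1) by omega, Nat.choose_symm_add]
  have hpt : ∑ J, γ J * ((∑ i ∈ J, x i : ℕ) : ℚ) = 0 := by
    rw [← hγ _ (good_point x) 1]
    · simp [Polynomial.coeff_one]
    · intro t _
      rw [latc_point]
      simp
  have hnn : ∀ J ∈ Finset.univ, 0 ≤ γ J * (z J : ℚ) - γ J * ((∑ i ∈ J, x i : ℕ) : ℚ) := by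
    intro J _
    by_cases h0 : J = ∅
    · subst h0; simp [hz.empty]
    by_cases h1 : J = Finset.univ
    · subst h1; rw [hxu]; simp
    have h2 := hneg J h0 h1
    have h3 : (z J : ℚ) ≤ ((∑ i ∈ J, x i : ℕ) : ℚ) := by exact_mod_cast hx J
    nlinarith
  suffices hfin : 0 < ∑ J, (γ J * (z J : ℚ) - γ J * ((∑ i ∈ J, x i : ℕ) : ℚ)) by
    rw [Finset.sum_sub_distrib, hpt, sub_zero] at hfin
    rw [hγ z hz p hp]
    exact hfin
  apply Finset.sum_pos' hnn
  refine ⟨J0, Finset.mem_univ _, ?_⟩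
  have h2 := hneg J0 (by rintro rfl; simp at hJ0) (by rintro rfl; omega)
  have h3 : (z J0 : ℚ) < ((∑ i ∈ J0, x i : ℕ) : ℚ) := by exact_mod_cast hJ0
  nlinarith

open Classical in
noncomputable def amin {n : ℕ} (W : Finset (Fin n → ℝ)) (c : Fin n → ℝ) : Finset (Fin n → ℝ) :=
  W.filter (fun v => ∀ w ∈ W, c ⬝ᵥ v ≤ c ⬝ᵥ w)

theorem mem_amin {n : ℕ} {W : Finset (Fin n → ℝ)} {c v : Fin n → ℝ} :
    v ∈ amin W c ↔ v ∈ W ∧ ∀ w ∈ W, c ⬝ᵥ v ≤ c ⬝ᵥ w := by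
  classical
  simp [amin]

theorem amin_nonempty {n : ℕ} {W : Finset (Fin n → ℝ)} (hW : W.Nonempty) (c : Fin n → ℝ) :
    (amin W c).Nonempty := by
  obtain ⟨v, hv, h⟩ := Finset.exists_min_image W (fun v => c ⬝ᵥ v) hW
  exact ⟨v, mem_amin.2 ⟨hv, h⟩⟩

theorem amin_perturb {n : ℕ} (W : Finset (Fin n → ℝ)) (hW : W.Nonempty) (c d : Fin n → ℝ) :
    ∃ c', amin W c' = amin (amin W c) d := by
  obtain ⟨v0, hv0⟩ := amin_nonempty (amin_nonempty hW c) d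
  have hv1 := (mem_amin.1 hv0).1
  have hv2 := mem_amin.1 hv1
  have hev : ∀ w ∈ W, ∀ᶠ ε : ℝ in nhdsWithin 0 (Set.Ioi 0), w ∉ amin W c →
      c ⬝ᵥ v0 + ε * (d ⬝ᵥ v0) < c ⬝ᵥ w + ε * (d ⬝ᵥ w) := by
    intro w hw
    by_cases hwM : w ∈ amin W c
    · simp [hwM]
    · have hlt : c ⬝ᵥ v0 < c ⬝ᵥ w := by
        by_contra hcon
        apply hwM
        rw [mem_amin]
        exact ⟨hw, fun u hu => (not_lt.1 hcon).trans (hv2.2 u hu)⟩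
      have h1 : Continuous (fun ε : ℝ => c ⬝ᵥ v0 + ε * (d ⬝ᵥ v0)) := by fun_prop
      have h2 : Continuous (fun ε : ℝ => c ⬝ᵥ w + ε * (d ⬝ᵥ w)) := by fun_prop
      have h3 : ∀ᶠ ε : ℝ in nhds 0, c ⬝ᵥ v0 + ε * (d ⬝ᵥ v0) < c ⬝ᵥ w + ε * (d ⬝ᵥ w) :=
        h1.continuousAt.eventually_lt h2.continuousAt (by simpa using hlt)
      filter_upwards [nhdsWithin_le_nhds h3] with ε hε _ using hε
  have hev2 := (Filter.eventually_all_finset W).2 hev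
  obtain ⟨ε, hε, hε0⟩ := (hev2.and self_mem_nhdsWithin).exists
  have hε0 : 0 < ε := hε0
  refine ⟨c + ε • d, ?_⟩
  have hdot : ∀ w, (c + ε • d) ⬝ᵥ w = c ⬝ᵥ w + ε * (d ⬝ᵥ w) := by
    intro w; rw [add_dotProduct, smul_dotProduct, smul_eq_mul]
  ext x
  rw [mem_amin, mem_amin]
  simp only [hdot]
  constructor
  · rintro ⟨hxW, hx⟩
    have hxM : x ∈ amin W c := by
      by_contra hxM
      exact absurd (hx v0 hv2.1) (not_le.2 (hε x hxW hxM))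
    refine ⟨hxM, fun w hw => ?_⟩
    have h1 := hx w (mem_amin.1 hw).1
    have h2 := (mem_amin.1 hw).2 x hxW
    have h3 : ε * (d ⬝ᵥ x) ≤ ε * (d ⬝ᵥ w) := by linarith
    exact le_of_mul_le_mul_left h3 hε0
  · rintro ⟨hxM, hx⟩
    have hxW := mem_amin.1 hxM
    refine ⟨hxW.1, fun w hw => ?_⟩
    by_cases hwM : w ∈ amin W c
    · have h1 := mul_le_mul_of_nonneg_left (hx w hwM) hε0.le
      have h2 := hxW.2 w hw
      linarith
    · have h1 := hε w hw hwM
      have h2 := mul_le_mul_of_nonneg_left (hx v0 hv1) hε0.le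
      have h3 := hxW.2 v0 hv2.1
      linarith

theorem face_eq {n : ℕ} (W : Finset (Fin n → ℝ)) (c : Fin n → ℝ) (hW : W.Nonempty) :
    {x ∈ convexHull ℝ (W : Set (Fin n → ℝ)) | ∀ y ∈ convexHull ℝ (W : Set (Fin n → ℝ)),
      c ⬝ᵥ x ≤ c ⬝ᵥ y} = convexHull ℝ (amin W c : Set (Fin n → ℝ)) := by
  obtain ⟨v0, hv0⟩ := amin_nonempty hW c
  have hv := mem_amin.1 hv0
  have hlin : IsLinearMap ℝ (fun x : Fin n → ℝ => c ⬝ᵥ x) :=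
    ⟨fun x y => dotProduct_add _ _ _, fun a x => dotProduct_smul _ _ _⟩
  have hge : ∀ y ∈ convexHull ℝ (W : Set (Fin n → ℝ)), c ⬝ᵥ v0 ≤ c ⬝ᵥ y := by
    intro y hy
    have : convexHull ℝ (W : Set (Fin n → ℝ)) ⊆ {y | c ⬝ᵥ v0 ≤ c ⬝ᵥ y} :=
      convexHull_min (fun w hw => hv.2 w hw) (convex_halfSpace_ge hlin _)
    exact this hy
  have hsub : (amin W c : Set (Fin n → ℝ)) ⊆ W := fun x hx => (mem_amin.1 hx).1
  have hle : ∀ y ∈ convexHull ℝ (amin W c : Set (Fin n → ℝ)), c ⬝ᵥ y ≤ c ⬝ᵥ v0 := by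
    intro y hy
    have : convexHull ℝ (amin W c : Set (Fin n → ℝ)) ⊆ {y | c ⬝ᵥ y ≤ c ⬝ᵥ v0} :=
      convexHull_min (fun w hw => (mem_amin.1 hw).2 v0 hv.1) (convex_halfSpace_le hlin _)
    exact this hy
  ext x
  constructor
  · rintro ⟨hx, hmin⟩
    have hS : convexHull ℝ (W : Set (Fin n → ℝ)) ⊆
        {y | c ⬝ᵥ v0 < c ⬝ᵥ y} ∪ convexHull ℝ (amin W c : Set (Fin n → ℝ)) := by
      apply convexHull_min
      · intro w hw
        by_cases hwM : w ∈ amin W c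
        · right; exact subset_convexHull _ _ hwM
        · left
          by_contra hcon
          apply hwM
          rw [mem_amin]
          exact ⟨hw, fun u hu => (not_lt.1 hcon).trans (hv.2 u hu)⟩
      · rw [convex_iff_forall_pos]
        have hge' : ∀ y ∈ convexHull ℝ (amin W c : Set (Fin n → ℝ)), c ⬝ᵥ v0 ≤ c ⬝ᵥ y :=
          fun y hy => hge y (convexHull_mono hsub hy)
        rintro x hx y hy a b ha hb hab
        by_cases hx2 : x ∈ convexHull ℝ (amin W c : Set (Fin n → ℝ))
        · by_cases hy2 : y ∈ convexHull ℝ (amin W c : Set (Fin n → ℝ))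
          · right; exact convex_convexHull ℝ _ hx2 hy2 ha.le hb.le hab
          · left
            have h1 := hge' x hx2
            have h2 : c ⬝ᵥ v0 < c ⬝ᵥ y := hy.resolve_right hy2
            change c ⬝ᵥ v0 < c ⬝ᵥ (a • x + b • y)
            rw [dotProduct_add, dotProduct_smul, dotProduct_smul, smul_eq_mul, smul_eq_mul]
            have : b = 1 - a := by linarith
            subst this
            nlinarith
        · left
          have h1 : c ⬝ᵥ v0 < c ⬝ᵥ x := hx.resolve_right hx2
          have h2 : c ⬝ᵥ v0 ≤ c ⬝ᵥ y := by
            rcases hy with hy | hy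
            · exact le_of_lt hy
            · exact hge' y hy
          change c ⬝ᵥ v0 < c ⬝ᵥ (a • x + b • y)
          rw [dotProduct_add, dotProduct_smul, dotProduct_smul, smul_eq_mul, smul_eq_mul]
          have : a = 1 - b := by linarith
          subst this
          nlinarith
    rcases hS hx with h | h
    · exact absurd (hmin v0 (subset_convexHull _ _ hv.1)) (not_le.2 h)
    · exact h
  · intro hx
    exact ⟨convexHull_mono hsub hx, fun y hy => (hle x hx).trans (hge y hy)⟩

theorem edge_exists {n : ℕ} (W : Finset (Fin n → ℝ)) (hW : W.Nonempty) : ∀ (N : ℕ) (c : Fin n → ℝ),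
    (amin W c).card = N → (∃ a ∈ amin W c, ∃ b ∈ amin W c, a ≠ b) →
    ∃ c', ∃ a ∈ amin W c, ∃ b ∈ amin W c, a ≠ b ∧
      convexHull ℝ (amin W c' : Set (Fin n → ℝ)) = segment ℝ a b := by
  intro N
  induction N using Nat.strong_induction_on with
  | _ N ih =>
  intro c hN hab
  by_cases hd : ∃ d, (∃ a ∈ amin (amin W c) d, ∃ b ∈ amin (amin W c) d, a ≠ b) ∧
      ∃ u ∈ amin W c, u ∉ amin (amin W c) d
  · obtain ⟨d, h1, u, hu, hu2⟩ := hd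
    obtain ⟨c', hc'⟩ := amin_perturb W hW c d
    have hsub : amin (amin W c) d ⊆ amin W c := fun x hx => (mem_amin.1 hx).1
    rw [← hc'] at h1 hu2 hsub
    obtain ⟨c'', a, ha, b, hb, hne, hseg⟩ := ih (amin W c').card (by
      rw [← hN]
      exact Finset.card_lt_card ((Finset.ssubset_iff_of_subset hsub).2 ⟨u, hu, hu2⟩)) c' rfl h1
    exact ⟨c'', a, hsub ha, b, hsub hb, hne, hseg⟩
  · push Not at hd
    obtain ⟨a0, ha0, b0, hb0, hne⟩ := hab
    obtain ⟨k0, hk0⟩ := Function.ne_iff.1 hne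
    set M := amin W c with hM
    have hMne : M.Nonempty := ⟨a0, ha0⟩
    obtain ⟨a, ha⟩ := amin_nonempty hMne (Pi.single k0 1)
    have ha' := mem_amin.1 ha
    simp only [single_one_dotProduct] at ha'
    have hlt : ∀ u ∈ M, u ≠ a → a k0 < u k0 := by
      intro u hu hua
      by_contra hcon
      have hu' : u ∈ amin M (Pi.single k0 1) := by
        rw [mem_amin]
        simp only [single_one_dotProduct]
        exact ⟨hu, fun w hw => (not_lt.1 hcon).trans (ha'.2 w hw)⟩
      have hall := hd (Pi.single k0 1) ⟨u, hu', a, ha, hua⟩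
      have h1 := mem_amin.1 (hall a0 ha0)
      have h2 := mem_amin.1 (hall b0 hb0)
      simp only [single_one_dotProduct] at h1 h2
      exact hk0 (le_antisymm (h1.2 b0 hb0) (h2.2 a0 ha0))
    have hslope : ∀ k, ∃ g : ℝ, ∀ u ∈ M, u k - a k = g * (u k0 - a k0) := by
      classical
      intro k
      have hne2 : (M.erase a).Nonempty := by
        by_cases h : a0 = a
        · exact ⟨b0, Finset.mem_erase.2 ⟨fun h' => hne (h.trans h'.symm), hb0⟩⟩
        · exact ⟨a0, Finset.mem_erase.2 ⟨h, ha0⟩⟩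
      obtain ⟨u0, hu0, hmin⟩ := Finset.exists_min_image (M.erase a)
        (fun u => (u k - a k) / (u k0 - a k0)) hne2
      rw [Finset.mem_erase] at hu0
      set g := (u0 k - a k) / (u0 k0 - a k0) with hg
      have hu0p : 0 < u0 k0 - a k0 := sub_pos.2 (hlt u0 hu0.2 hu0.1)
      have hu0g : u0 k - a k = g * (u0 k0 - a k0) := by rw [hg]; field_simp
      have hgle : ∀ u ∈ M, g * (u k0 - a k0) ≤ u k - a k := by
        intro u hu
        by_cases hua : u = a
        · subst hua; simp
        · have := hmin u (Finset.mem_erase.2 ⟨hua, hu⟩)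
          exact (le_div_iff₀ (sub_pos.2 (hlt u hu hua))).1 this
      let d : Fin n → ℝ := Pi.single k 1 - g • Pi.single k0 1
      have hdd : ∀ u : Fin n → ℝ, d ⬝ᵥ u = u k - g * u k0 := by
        intro u
        simp only [d, sub_dotProduct, smul_dotProduct, single_one_dotProduct, smul_eq_mul]
      have h1 : a ∈ amin M d := by
        rw [mem_amin]
        refine ⟨ha'.1, fun w hw => ?_⟩
        rw [hdd, hdd]
        linarith [hgle w hw]
      have h2 : u0 ∈ amin M d := by
        rw [mem_amin]
        refine ⟨hu0.2, fun w hw => ?_⟩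
        rw [hdd, hdd]
        linarith [hgle w hw]
      have hall := hd d ⟨u0, h2, a, h1, hu0.1⟩
      refine ⟨g, fun u hu => ?_⟩
      have h3 := (mem_amin.1 (hall u hu)).2 a ha'.1
      rw [hdd, hdd] at h3
      linarith [hgle u hu]
    choose g hg using hslope
    obtain ⟨b, hb, hbmax⟩ := Finset.exists_max_image M (fun u => u k0) hMne
    have hba : a ≠ b := by
      rintro rfl
      have h1 : ∀ u ∈ M, u = a := by
        intro u hu
        by_contra hua
        exact absurd (hbmax u hu) (not_le.2 (hlt u hu hua))
      exact hne ((h1 a0 ha0).trans (h1 b0 hb0).symm)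
    refine ⟨c, a, ha'.1, b, hb, hba, ?_⟩
    apply Set.Subset.antisymm
    · apply convexHull_min _ (convex_segment a b)
      intro u hu
      have hu : u ∈ M := hu
      have hbp : 0 < b k0 - a k0 := sub_pos.2 (hlt b hb hba.symm)
      rw [segment_eq_image']
      refine ⟨(u k0 - a k0) / (b k0 - a k0), ⟨div_nonneg (sub_nonneg.2 (ha'.2 u hu)) hbp.le, ?_⟩, ?_⟩
      · rw [div_le_one hbp]
        linarith [hbmax u hu]
      · ext k
        simp only [Pi.add_apply, Pi.smul_apply, Pi.sub_apply, smul_eq_mul]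
        rw [hg k b hb]
        have := hg k u hu
        field_simp
        linarith
    · exact segment_subset_convexHull ha'.1 hb

theorem unique_min {n : ℕ} (W : Finset (Fin n → ℝ)) (hW : W.Nonempty)
    (hedge : ∀ F : Set (Fin n → ℝ), IsExposed ℝ (convexHull ℝ (W : Set (Fin n → ℝ))) F →
      ∀ v w : Fin n → ℝ, v ≠ w → F = segment ℝ v w →
      ∃ i j : Fin n, ∃ c : ℝ, c ≠ 0 ∧
        w - v = c • (Pi.single i (1 : ℝ) - Pi.single j (1 : ℝ)))
    (c : Fin n → ℝ) (hc : Function.Injective c) (v w : Fin n → ℝ)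
    (hv : v ∈ amin W c) (hw : w ∈ amin W c) : v = w := by
  by_contra hne
  obtain ⟨c', a, ha, b, hb, hab, hseg⟩ := edge_exists W hW _ c rfl ⟨v, hv, w, hw, hne⟩
  have hex : IsExposed ℝ (convexHull ℝ (W : Set (Fin n → ℝ))) (segment ℝ a b) := by
    intro _
    let l : (Fin n → ℝ) →ₗ[ℝ] ℝ := 
      { toFun := fun x => - (c' ⬝ᵥ x)
        map_add' := fun x y => by rw [dotProduct_add]; ring
        map_smul' := fun r x => by rw [dotProduct_smul]; simp }
    refine ⟨LinearMap.toContinuousLinearMap l, ?_⟩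
    rw [← hseg, ← face_eq W c' hW]
    ext x
    simp [l]
  obtain ⟨i, j, k, hk, hkk⟩ := hedge _ hex a b hab rfl
  have h1 : c ⬝ᵥ (b - a) = 0 := by
    rw [dotProduct_sub]
    linarith [(mem_amin.1 ha).2 b (mem_amin.1 hb).1, (mem_amin.1 hb).2 a (mem_amin.1 ha).1]
  rw [hkk, dotProduct_smul, dotProduct_sub, dotProduct_single_one, dotProduct_single_one,
    smul_eq_mul] at h1
  have h2 : c i = c j := by
    rcases mul_eq_zero.1 h1 with h | h
    · exact absurd h hk
    · linarith
  have h3 := hc h2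
  subst h3
  simp only [sub_self, smul_zero] at hkk
  exact hab (sub_eq_zero.1 hkk).symm

theorem path_min {n : ℕ} (W : Finset (Fin n → ℝ))
    (H : ∀ c : Fin n → ℝ, Function.Injective c → ∀ v w, v ∈ amin W c → w ∈ amin W c → v = w)
    (c0 c1 : Fin n → ℝ) (hinj : ∀ s : ℝ, 0 ≤ s → Function.Injective (c0 + s • c1))
    (v : Fin n → ℝ) (hv : v ∈ amin W c0) : v ∈ amin W c1 := by
  classical
  rw [mem_amin] at hv ⊢
  refine ⟨hv.1, ?_⟩
  by_contra hcon
  push Not at hcon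
  obtain ⟨w0, hw0, hlt0⟩ := hcon
  obtain ⟨w, hw, hmin⟩ := Finset.exists_min_image (W.filter (fun w => c1 ⬝ᵥ w < c1 ⬝ᵥ v))
    (fun w => (c0 ⬝ᵥ w - c0 ⬝ᵥ v) / (c1 ⬝ᵥ v - c1 ⬝ᵥ w)) ⟨w0, by simp [hw0, hlt0]⟩
  rw [Finset.mem_filter] at hw
  set s := (c0 ⬝ᵥ w - c0 ⬝ᵥ v) / (c1 ⬝ᵥ v - c1 ⬝ᵥ w) with hs
  have hwp : 0 < c1 ⬝ᵥ v - c1 ⬝ᵥ w := sub_pos.2 hw.2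
  have hs0 : 0 ≤ s := div_nonneg (sub_nonneg.2 (hv.2 w hw.1)) hwp.le
  have hsw : s * (c1 ⬝ᵥ v - c1 ⬝ᵥ w) = c0 ⬝ᵥ w - c0 ⬝ᵥ v := by rw [hs]; field_simp
  have hdot : ∀ u, (c0 + s • c1) ⬝ᵥ u = c0 ⬝ᵥ u + s * (c1 ⬝ᵥ u) := by
    intro w; rw [add_dotProduct, smul_dotProduct, smul_eq_mul]
  have hvmin : ∀ u ∈ W, c0 ⬝ᵥ v + s * (c1 ⬝ᵥ v) ≤ c0 ⬝ᵥ u + s * (c1 ⬝ᵥ u) := by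
    intro u hu
    by_cases hlt : c1 ⬝ᵥ u < c1 ⬝ᵥ v
    · have h1 := hmin u (Finset.mem_filter.2 ⟨hu, hlt⟩)
      have h2 := (le_div_iff₀ (sub_pos.2 hlt)).1 h1
      linarith
    · have h1 := mul_le_mul_of_nonneg_left (not_lt.1 hlt) hs0
      linarith [hv.2 u hu]
  have := H (c0 + s • c1) (hinj s hs0) v w
    (mem_amin.2 ⟨hv.1, fun u hu => by rw [hdot, hdot]; exact hvmin u hu⟩)
    (mem_amin.2 ⟨hw.1, fun u hu => by rw [hdot, hdot]; linarith [hvmin u hu]⟩)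
  subst this
  exact absurd hw.2 (lt_irrefl _)

theorem perm_min {n : ℕ} (W : Finset (Fin n → ℝ)) (hW : W.Nonempty)
    (H : ∀ c : Fin n → ℝ, Function.Injective c → ∀ v w, v ∈ amin W c → w ∈ amin W c → v = w)
    (σ : Equiv.Perm (Fin n)) : ∃ v ∈ W, ∀ c : Fin n → ℝ, Monotone (c ∘ σ) →
      ∀ w ∈ W, c ⬝ᵥ v ≤ c ⬝ᵥ w := by
  let c0 : Fin n → ℝ := fun i => ((σ.symm i : ℕ) : ℝ)
  obtain ⟨v, hv⟩ := amin_nonempty hW c0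
  refine ⟨v, (mem_amin.1 hv).1, fun c hc => ?_⟩
  refine (mem_amin.1 (path_min W H c0 c ?_ v hv)).2
  intro s hs
  have hsm : StrictMono ((c0 + s • c) ∘ σ) := by
    intro a b hab
    have h1 := hc hab.le
    simp only [Function.comp, Pi.add_apply, Pi.smul_apply, smul_eq_mul, c0,
      Equiv.symm_apply_apply] at h1 ⊢
    have h2 : ((a : ℕ) : ℝ) < ((b : ℕ) : ℝ) := by exact_mod_cast hab
    have h3 := mul_le_mul_of_nonneg_left h1 hs
    linarith
  have := hsm.injective.comp σ.symm.injective
  convert this using 1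
  ext i
  simp

theorem abel_fin : ∀ (n : ℕ) (f d : Fin (n + 1) → ℝ), Monotone f →
    (∀ i, 0 ≤ ∑ k, if i ≤ k then d k else 0) → f 0 * ∑ k, d k ≤ ∑ k, f k * d k := by
  intro n
  induction n with
  | zero => intro f d _ _; simp
  | succ n ih =>
    intro f d hf hd
    have h1 := ih (fun i => f i.succ) (fun i => d i.succ)
      (fun a b hab => hf (Fin.succ_le_succ_iff.2 hab)) (fun i => by
        have := hd i.succ
        rw [Fin.sum_univ_succ] at this
        simpa [Fin.succ_le_succ_iff] using this)
    have h2 := hd (Fin.succ 0)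
    rw [Fin.sum_univ_succ] at h2
    simp only [Fin.succ_le_succ_iff, Fin.zero_le, if_true] at h2
    have h3 : f 0 ≤ f (Fin.succ 0) := hf (Fin.zero_le _)
    have h4 : 0 ≤ ∑ k : Fin (n + 1), d k.succ := by simpa using h2
    rw [Fin.sum_univ_succ, Fin.sum_univ_succ (fun k => f k * d k)]
    have h5 := mul_le_mul_of_nonneg_right h3 h4
    linarith

def PM {n : ℕ} (V : Finset (Fin n → ℤ)) : Prop :=
  ∀ σ : Equiv.Perm (Fin n), ∃ v ∈ V, ∀ c : Fin n → ℝ, Monotone (c ∘ σ) →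
      ∀ w ∈ V, ∑ i, c i * (v i : ℝ) ≤ ∑ i, c i * (w i : ℝ)

theorem PM_of_edge {n : ℕ} (V : Finset (Fin n → ℤ)) (hV : V.Nonempty)
    (P : Set (Fin n → ℝ))
    (hP : P = convexHull ℝ ((fun v : Fin n → ℤ => (fun i => (v i : ℝ))) '' ↑V))
    (hedge : ∀ F : Set (Fin n → ℝ), IsExposed ℝ P F →
      ∀ v w : Fin n → ℝ, v ≠ w → F = segment ℝ v w →
      ∃ i j : Fin n, ∃ c : ℝ, c ≠ 0 ∧
        w - v = c • (Pi.single i (1 : ℝ) - Pi.single j (1 : ℝ))) : PM V := by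
  classical
  intro σ
  have hW : (V.image (fun v : Fin n → ℤ => (fun i => (v i : ℝ)))).Nonempty := hV.image _
  have hP' : P = convexHull ℝ
      ((V.image (fun v : Fin n → ℤ => (fun i => (v i : ℝ))) : Finset _) : Set (Fin n → ℝ)) := by
    rw [hP, Finset.coe_image]
  subst hP'
  obtain ⟨v, hv, h⟩ := perm_min _ hW (unique_min _ hW hedge) σ
  obtain ⟨v', hv', rfl⟩ := Finset.mem_image.1 hv
  refine ⟨v', hv', fun c hc w hw => ?_⟩
  exact h c hc _ (Finset.mem_image_of_mem _ hw)

noncomputable def zZ {n : ℕ} (V : Finset (Fin n → ℤ)) (hV : V.Nonempty)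
    (J : Finset (Fin n)) : ℤ := V.inf' hV (fun v => ∑ i ∈ J, v i)

theorem zZ_le {n : ℕ} (V : Finset (Fin n → ℤ)) (hV : V.Nonempty) (J : Finset (Fin n))
    (v : Fin n → ℤ) (hv : v ∈ V) : zZ V hV J ≤ ∑ i ∈ J, v i :=
  Finset.inf'_le (fun v : Fin n → ℤ => ∑ i ∈ J, v i) hv

theorem zZ_att {n : ℕ} (V : Finset (Fin n → ℤ)) (hV : V.Nonempty) (J : Finset (Fin n)) :
    ∃ v ∈ V, zZ V hV J = ∑ i ∈ J, v i :=
  Finset.exists_mem_eq_inf' hV _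

theorem zZ_eq {n : ℕ} (V : Finset (Fin n → ℤ)) (hV : V.Nonempty) (J : Finset (Fin n))
    (v : Fin n → ℤ) (hv : v ∈ V) (h : ∀ w ∈ V,
      ∑ i, (if i ∈ J then (1 : ℝ) else 0) * (v i : ℝ)
        ≤ ∑ i, (if i ∈ J then (1 : ℝ) else 0) * (w i : ℝ)) :
    zZ V hV J = ∑ i ∈ J, v i := by
  apply le_antisymm (zZ_le V hV J v hv)
  obtain ⟨w, hw, e⟩ := zZ_att V hV J
  rw [e]
  have := h w hw
  simp only [ite_mul, one_mul, zero_mul, Finset.sum_ite_mem, Finset.univ_inter] at this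
  exact_mod_cast this

theorem zZ_univ {n : ℕ} (V : Finset (Fin n → ℤ)) (hV : V.Nonempty) (h : PM V)
    (v : Fin n → ℤ) (hv : v ∈ V) : ∑ i, v i = zZ V hV Finset.univ := by
  obtain ⟨u, hu, hc⟩ := h (Equiv.refl _)
  have h2 : ∀ w ∈ V, ∑ i, w i = ∑ i, u i := by
    intro w hw
    have h1 := hc (fun _ => 1) (fun _ _ _ => le_rfl) w hw
    have h2 := hc (fun _ => -1) (fun _ _ _ => le_rfl) w hw
    simp only [one_mul, neg_mul, Finset.sum_neg_distrib] at h1 h2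
    have : ∑ i, (w i : ℝ) = ∑ i, (u i : ℝ) := by linarith
    exact_mod_cast this
  obtain ⟨w, hw, e⟩ := zZ_att V hV Finset.univ
  rw [e, h2 w hw, h2 v hv]

theorem zZ_super {n : ℕ} (V : Finset (Fin n → ℤ)) (hV : V.Nonempty) (h : PM V)
    (A B : Finset (Fin n)) :
    zZ V hV A + zZ V hV B ≤ zZ V hV (A ∪ B) + zZ V hV (A ∩ B) := by
  let g : Fin n → ℝ := fun i => (if i ∈ A ∩ B then (1 : ℝ) else 0) +
    (if i ∈ A ∪ B then (1 : ℝ) else 0)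
  obtain ⟨v, hv, hc⟩ := h (Tuple.sort g)
  have hs := Tuple.monotone_sort g
  have key : ∀ a b : Fin n, g a ≤ g b → (a ∈ A ∩ B → b ∈ A ∩ B) ∧ (a ∈ A ∪ B → b ∈ A ∪ B) := by
    intro a b hab
    simp only [g, Finset.mem_inter, Finset.mem_union] at hab ⊢
    by_cases h1 : a ∈ A <;> by_cases h2 : a ∈ B <;> by_cases h3 : b ∈ A <;>
      by_cases h4 : b ∈ B <;> simp [h1, h2, h3, h4] at hab ⊢ <;> norm_num at hab
  have e1 := zZ_eq V hV (A ∩ B) v hv (hc _ (by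
    intro a b hab
    have := (key _ _ (hs hab)).1
    simp only [Function.comp]
    split_ifs <;> simp_all))
  have e2 := zZ_eq V hV (A ∪ B) v hv (hc _ (by
    intro a b hab
    have := (key _ _ (hs hab)).2
    simp only [Function.comp]
    split_ifs with h1 h2
    · exact le_rfl
    · exact absurd (this h1) h2
    · exact zero_le_one
    · exact le_rfl))
  rw [e1, e2, Finset.sum_union_inter]
  exact add_le_add (zZ_le V hV A v hv) (zZ_le V hV B v hv)

theorem dot_sep {m : ℕ} (V : Finset (Fin (m+1) → ℤ)) (hV : V.Nonempty) (h : PM V)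
    (y : Fin (m+1) → ℝ) (hy : ∀ J, (zZ V hV J : ℝ) ≤ ∑ i ∈ J, y i)
    (hyu : ∑ i, y i = zZ V hV Finset.univ) (c : Fin (m+1) → ℝ) :
    ∃ v ∈ V, ∑ i, c i * (v i : ℝ) ≤ ∑ i, c i * y i := by
  obtain ⟨v, hv, hc⟩ := h (Tuple.sort c)
  refine ⟨v, hv, ?_⟩
  set σ := Tuple.sort c with hσ
  have ha := abel_fin m (c ∘ σ) (fun k => y (σ k) - v (σ k)) (Tuple.monotone_sort c) (by
    intro k0
    have e := zZ_eq V hV (Finset.univ.filter (fun i => k0 ≤ σ.symm i)) v hv (hc _ (by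
      intro a b hab
      simp only [Function.comp, Finset.mem_filter, Finset.mem_univ, true_and,
        Equiv.symm_apply_apply]
      split_ifs with h1 h2
      · exact le_rfl
      · exact absurd (h1.trans hab) h2
      · exact zero_le_one
      · exact le_rfl))
    have h1 := hy (Finset.univ.filter (fun i => k0 ≤ σ.symm i))
    rw [e, Finset.sum_filter] at h1
    push_cast at h1
    rw [Finset.sum_filter] at h1
    rw [← Equiv.sum_comp σ (fun a => if k0 ≤ σ.symm a then y a else 0),
      ← Equiv.sum_comp σ (fun a => if k0 ≤ σ.symm a then (v a : ℝ) else 0)] at h1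
    simp only [Equiv.symm_apply_apply] at h1
    have : ∑ k, (if k0 ≤ k then y (σ k) - v (σ k) else 0) =
        ∑ k, (if k0 ≤ k then y (σ k) else 0) - ∑ k, (if k0 ≤ k then (v (σ k) : ℝ) else 0) := by
      rw [← Finset.sum_sub_distrib]
      refine Finset.sum_congr rfl fun k _ => ?_
      split_ifs <;> simp
    rw [this]
    linarith)
  have hz : ∑ k, (y (σ k) - v (σ k)) = 0 := by
    rw [Equiv.sum_comp σ (fun k => y k - (v k : ℝ)), Finset.sum_sub_distrib, hyu,
      ← zZ_univ V hV h v hv]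
    push_cast
    ring
  rw [hz, mul_zero] at ha
  have e2 : ∑ k, (c ∘ σ) k * (y (σ k) - v (σ k)) = ∑ k, c k * (y k - v k) :=
    Equiv.sum_comp σ (fun k => c k * (y k - (v k : ℝ)))
  rw [e2] at ha
  simp only [mul_sub, Finset.sum_sub_distrib] at ha
  linarith

theorem mem_hull_iff {m : ℕ} (V : Finset (Fin (m+1) → ℤ)) (hV : V.Nonempty) (h : PM V)
    (y : Fin (m+1) → ℝ) :
    y ∈ convexHull ℝ ((fun v : Fin (m+1) → ℤ => (fun i => (v i : ℝ))) '' (V : Set _)) ↔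
      (∀ J, (zZ V hV J : ℝ) ≤ ∑ i ∈ J, y i) ∧ ∑ i, y i = zZ V hV Finset.univ := by
  constructor
  · intro hy
    have hconv : Convex ℝ {y : Fin (m+1) → ℝ |
        (∀ J, (zZ V hV J : ℝ) ≤ ∑ i ∈ J, y i) ∧ ∑ i, y i = zZ V hV Finset.univ} := by
      intro a ha b hb s t hs ht hst
      simp only [Set.mem_ofPred_eq] at ha hb ⊢
      simp only [Pi.add_apply, Pi.smul_apply, smul_eq_mul, Finset.sum_add_distrib,
        ← Finset.mul_sum]
      constructor
      · intro J
        have h1 := mul_le_mul_of_nonneg_left (ha.1 J) hs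
        have h2 := mul_le_mul_of_nonneg_left (hb.1 J) ht
        calc (zZ V hV J : ℝ) = s * zZ V hV J + t * zZ V hV J := by rw [← add_mul, hst, one_mul]
          _ ≤ _ := add_le_add h1 h2
      · rw [ha.2, hb.2, ← add_mul, hst, one_mul]
    refine convexHull_min ?_ hconv hy
    rintro _ ⟨v, hv, rfl⟩
    refine ⟨fun J => ?_, ?_⟩
    · beta_reduce
      exact_mod_cast zZ_le V hV J v hv
    · beta_reduce
      exact_mod_cast zZ_univ V hV h v hv
  · rintro ⟨hy, hyu⟩
    by_contra hn
    have hcl : IsClosed (convexHull ℝ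
        ((fun v : Fin (m+1) → ℤ => (fun i => (v i : ℝ))) '' (V : Set _))) :=
      ((V.finite_toSet.image _).isCompact_convexHull ℝ).isClosed
    obtain ⟨f, u, hf1, hf2⟩ := geometric_hahn_banach_point_closed (convex_convexHull ℝ _) hcl hn
    have hf : ∀ x : Fin (m+1) → ℝ, f x = ∑ i, f (Pi.single i 1) * x i := by
      intro x
      conv_lhs => rw [← Finset.univ_sum_single x]
      rw [map_sum]
      refine Finset.sum_congr rfl fun i _ => ?_
      have : (Pi.single i (x i) : Fin (m+1) → ℝ) = x i • Pi.single i 1 := by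
        rw [← Pi.single_smul]; simp
      rw [this, map_smul, smul_eq_mul, mul_comm]
    obtain ⟨v, hv, hle⟩ := dot_sep V hV h y hy hyu (fun i => f (Pi.single i 1))
    have h3 := hf2 _ (subset_convexHull ℝ _ ⟨v, hv, rfl⟩)
    rw [hf] at hf1 h3
    linarith

theorem mem_dil_iff {m : ℕ} (V : Finset (Fin (m+1) → ℤ)) (hV : V.Nonempty) (h : PM V)
    (t : ℕ) (ht : 1 ≤ t) (x : Fin (m+1) → ℤ) :
    (fun i => (x i : ℝ)) ∈ (t : ℝ) • convexHull ℝ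
      ((fun v : Fin (m+1) → ℤ => (fun i => (v i : ℝ))) '' (V : Set _)) ↔
      (∀ J, t * zZ V hV J ≤ ∑ i ∈ J, x i) ∧ ∑ i, x i = t * zZ V hV Finset.univ := by
  have ht0 : (0 : ℝ) < t := by exact_mod_cast ht
  rw [Set.mem_smul_set_iff_inv_smul_mem₀ ht0.ne', mem_hull_iff V hV h]
  simp only [Pi.smul_apply, smul_eq_mul, ← Finset.mul_sum]
  refine and_congr (forall_congr' fun J => ?_) ?_
  · rw [inv_mul_eq_div, le_div_iff₀ ht0, mul_comm]
    exact_mod_cast Iff.rfl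
  · rw [inv_mul_eq_div, div_eq_iff ht0.ne', mul_comm]
    exact_mod_cast Iff.rfl

theorem final_aux (m : ℕ) (V : Finset (Fin (m+1) → ℤ)) (hV : V.Nonempty) (h : PM V)
    (hne : ∃ v ∈ V, ∃ w ∈ V, v ≠ w) (p : Polynomial ℚ)
    (hp : ∀ t : ℕ, 1 ≤ t → p.eval (t : ℚ) =
      (Set.ncard {x : Fin (m+1) → ℤ | (∀ J, t * zZ V hV J ≤ ∑ i ∈ J, x i) ∧
        ∑ i, x i = t * zZ V hV Finset.univ} : ℚ)) :
    0 < p.coeff 1 := by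
  classical
  obtain ⟨A, hA⟩ : ∃ A : ℕ, ∀ v ∈ V, ∀ i, 0 ≤ v i + A := by
    refine ⟨∑ v ∈ V, ∑ i, (v i).natAbs, fun v hv i => ?_⟩
    have h1 : (v i).natAbs ≤ ∑ i, (v i).natAbs :=
      Finset.single_le_sum (f := fun i => (v i).natAbs) (fun _ _ => Nat.zero_le _)
        (Finset.mem_univ i)
    have h2 : ∑ i, (v i).natAbs ≤ ∑ v ∈ V, ∑ i, (v i).natAbs :=
      Finset.single_le_sum (f := fun v : Fin (m+1) → ℤ => ∑ i, (v i).natAbs)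
        (fun _ _ => Nat.zero_le _) hv
    omega
  have hnn : ∀ J, 0 ≤ zZ V hV J + A * J.card := by
    intro J
    obtain ⟨v, hv, e⟩ := zZ_att V hV J
    rw [e]
    have : ∑ i ∈ J, (v i + A) = ∑ i ∈ J, v i + A * J.card := by
      rw [Finset.sum_add_distrib]; simp [mul_comm]
    rw [← this]
    exact Finset.sum_nonneg fun i _ => hA v hv i
  let z : Finset (Fin (m+1)) → ℕ := fun J => (zZ V hV J + A * J.card).toNat
  have hz : ∀ J, (z J : ℤ) = zZ V hV J + A * J.card := fun J => Int.toNat_of_nonneg (hnn J)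
  have hsumA : ∀ (J : Finset (Fin (m+1))) (x : Fin (m+1) → ℤ) (s : ℤ),
      ∑ i ∈ J, (x i + s) = ∑ i ∈ J, x i + s * J.card := by
    intro J x s
    rw [Finset.sum_add_distrib]; simp [mul_comm]
  have hgood : Good z := by
    constructor
    · have : (z ∅ : ℤ) = 0 := by
        rw [hz]
        obtain ⟨v, hv, e⟩ := zZ_att V hV ∅
        rw [e]; simp
      exact_mod_cast this
    · intro J K hJK
      have : (z J : ℤ) ≤ z K := by
        rw [hz, hz]
        obtain ⟨v, hv, e⟩ := zZ_att V hV K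
        rw [e, ← hsumA]
        refine le_trans ?_ (Finset.sum_le_sum_of_subset_of_nonneg hJK
          (fun i _ _ => hA v hv i))
        rw [hsumA]
        have := zZ_le V hV J v hv
        linarith
      exact_mod_cast this
    · intro B C
      have : (z B : ℤ) + z C ≤ z (B ∪ C) + z (B ∩ C) := by
        rw [hz, hz, hz, hz]
        have h1 := zZ_super V hV h B C
        have h2 : ((B ∪ C).card : ℤ) + (B ∩ C).card = B.card + C.card := by
          exact_mod_cast Finset.card_union_add_card_inter B C
        have h3 : (A : ℤ) * (B ∪ C).card + A * (B ∩ C).card = A * B.card + A * C.card := by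
          rw [← mul_add, ← mul_add, h2]
        linarith
      exact_mod_cast this
  have hcount : ∀ t : ℕ, Set.ncard {x : Fin (m+1) → ℤ |
      (∀ J, t * zZ V hV J ≤ ∑ i ∈ J, x i) ∧
        ∑ i, x i = t * zZ V hV Finset.univ} = latc (fun J => t * z J) := by
    intro t
    unfold latc
    rw [← Set.ncard_coe_finset]
    symm
    refine Set.ncard_congr (fun (x : Fin (m+1) → ℕ) _ => fun i => (x i : ℤ) - t * A) ?_ ?_ ?_
    · intro x hx
      simp only [Finset.coe_filter, Set.mem_ofPred_eq] at hx ⊢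
      obtain ⟨_, hx1, hx2⟩ := hx
      simp only [sub_eq_add_neg, hsumA]
      constructor
      · intro J
        have h1 : (t : ℤ) * z J ≤ ∑ i ∈ J, (x i : ℤ) := by exact_mod_cast hx2 J
        rw [hz] at h1
        linarith
      · have h1 : ∑ i, (x i : ℤ) = (t : ℤ) * z Finset.univ := by exact_mod_cast hx1
        rw [h1, hz]
        ring
    · intro x y _ _ hxy
      funext i
      have := congrFun hxy i
      omega
    · intro y hy
      simp only [Set.mem_ofPred_eq] at hy
      obtain ⟨hy1, hy2⟩ := hy
      have hnn' : ∀ i, 0 ≤ y i + t * A := by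
        intro i
        have h1 := hy1 {i}
        have h2 := hnn {i}
        simp only [Finset.sum_singleton, Finset.card_singleton, Nat.cast_one, mul_one] at h1 h2
        have h3 := mul_nonneg (Int.natCast_nonneg t) h2
        linarith
      have hc : ∀ i, (((y i + t * A).toNat : ℕ) : ℤ) = y i + t * A :=
        fun i => Int.toNat_of_nonneg (hnn' i)
      have hsum : ∑ i, (y i + t * A).toNat = t * z Finset.univ := by
        have : ((∑ i, (y i + t * A).toNat : ℕ) : ℤ) = (t : ℤ) * z Finset.univ := by
          rw [Nat.cast_sum]
          simp only [hc]
          rw [hsumA, hz, hy2]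
          ring
        exact_mod_cast this
      refine ⟨fun i => (y i + t * A).toNat, ?_, ?_⟩
      · simp only [Finset.coe_filter, Set.mem_ofPred_eq, Fintype.mem_piFinset, Finset.mem_range]
        refine ⟨fun i => ?_, hsum, fun J => ?_⟩
        · rw [Nat.lt_succ_iff, ← hsum]
          exact Finset.single_le_sum (f := fun i => (y i + t * A).toNat)
            (fun _ _ => Nat.zero_le _) (Finset.mem_univ i)
        · have : (t : ℤ) * z J ≤ ((∑ i ∈ J, (y i + t * A).toNat : ℕ) : ℤ) := by
            rw [Nat.cast_sum]
            simp only [hc]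
            rw [hsumA, hz]
            have := hy1 J
            linarith
          exact_mod_cast this
      · funext i
        simp only [hc]
        ring
  obtain ⟨v, hv, w, hw, i, hlt⟩ : ∃ v ∈ V, ∃ w ∈ V, ∃ i, w i < v i := by
    obtain ⟨v, hv, w, hw, hvw⟩ := hne
    obtain ⟨i, hi⟩ := Function.ne_iff.1 hvw
    rcases lt_or_gt_of_ne hi with h1 | h1
    · exact ⟨w, hw, v, hv, i, h1⟩
    · exact ⟨v, hv, w, hw, i, h1⟩
  have hcv : ∀ i, (((v i + A).toNat : ℕ) : ℤ) = v i + A :=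
    fun i => Int.toNat_of_nonneg (hA v hv i)
  refine latc_positive m z hgood p (fun t ht => ?_) (fun i => (v i + A).toNat) ?_ ?_ {i} ?_
  · rw [hp t ht, hcount t]
  · intro J
    have : (z J : ℤ) ≤ ((∑ i ∈ J, (v i + A).toNat : ℕ) : ℤ) := by
      rw [Nat.cast_sum]
      simp only [hcv]
      rw [hsumA, hz]
      have := zZ_le V hV J v hv
      linarith
    exact_mod_cast this
  · have : ((∑ i, (v i + A).toNat : ℕ) : ℤ) = z Finset.univ := by
      rw [Nat.cast_sum]
      simp only [hcv]
      rw [hsumA, hz, zZ_univ V hV h v hv]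
    exact_mod_cast this
  · have h1 := zZ_le V hV {i} w hw
    have h2 := hz {i}
    have h3 := hcv i
    simp only [Finset.sum_singleton, Finset.card_singleton, Nat.cast_one, mul_one] at h1 h2 ⊢
    omega



/-- Theorem `thm:linear`: let `P ⊂ ℝ^n` be a lattice polytope of
dimension at least 1 which is a lattice generalized permutohedron, i.e. every edge
(one-dimensional exposed face, necessarily a segment between its two endpoints) is
parallel to some `e_i − e_j`.  If `p` is a polynomial with `p(t) = |tP ∩ ℤ^n|` for
all positive integers `t`, then the linear coefficient of `p` is positive. -/
theorem stmt13 (n : ℕ) (hn : 1 ≤ n) (V : Finset (Fin n → ℤ)) (hV : V.Nonempty)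
    (P : Set (Fin n → ℝ))
    (hP : P = convexHull ℝ ((fun v : Fin n → ℤ => (fun i => (v i : ℝ))) '' ↑V))
    (hdim : ∃ x ∈ P, ∃ y ∈ P, x ≠ y)
    (hedge : ∀ F : Set (Fin n → ℝ), IsExposed ℝ P F →
      ∀ v w : Fin n → ℝ, v ≠ w → F = segment ℝ v w →
      ∃ i j : Fin n, ∃ c : ℝ, c ≠ 0 ∧
        w - v = c • (Pi.single i (1 : ℝ) - Pi.single j (1 : ℝ)))
    (p : Polynomial ℚ)
    (hp : ∀ t : ℕ, 1 ≤ t → p.eval (t : ℚ) =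
      (Set.ncard {x : Fin n → ℤ | (fun i => (x i : ℝ)) ∈ (t : ℝ) • P} : ℚ)) :
    0 < p.coeff 1 := by
  obtain ⟨m, rfl⟩ : ∃ m, n = m + 1 := ⟨n - 1, by omega⟩
  have h := PM_of_edge V hV P hP hedge
  refine final_aux m V hV h ?_ p ?_
  · by_contra hcon
    push Not at hcon
    obtain ⟨v, hv⟩ := hV
    have : (V : Set (Fin (m+1) → ℤ)) = {v} := by
      ext w
      simp only [Finset.mem_coe, Set.mem_singleton_iff]
      exact ⟨fun hw => hcon w hw v hv, fun e => e ▸ hv⟩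
    rw [this, Set.image_singleton, convexHull_singleton] at hP
    obtain ⟨x, hx, y, hy, hxy⟩ := hdim
    rw [hP] at hx hy
    exact hxy (hx.trans hy.symm)
  · intro t ht
    rw [hp t ht, hP]
    simp only [mem_dil_iff V hV h t ht]
end
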